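/- arXiv:math/9706219 — 2 statements merged into one kernel-verified Lean document; each statement's English description precedes it below -/
import Mathlib

section
/- For n ≥ 1 and 0 ≤ k ≤ n-1, Σ_{σ ∈ S_n, des(σ)=k} q^{maj(σ)} = T_{n-k-1}(B(n); q), where B(n) is the staircase board of all squares (i,j) with 1 ≤ i < j ≤ n. -/
open Finset
open scoped Classical

noncomputable section

variable {R : Type*} [CommRing R]

/-- The q-integer `[m]_q = 1 + q + ... + q^{m-1}`. -/
def qint (q : R) (m : ℕ) : R := ∑ i ∈ Finset.range m, q ^ i

/-- The q-factorial `[m]_q!`. -/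
def qfact (q : R) (m : ℕ) : R := ∏ i ∈ Finset.range m, qint q (i + 1)

/-- A Ferrers board inside the `n × n` grid, given by column heights `c`:
square `(i,j)` (0-based row `i`, column `j`) belongs to the board iff `i < c j`. -/
def IsFerrers (n : ℕ) (c : Fin n → ℕ) : Prop := Monotone c ∧ ∀ j, c j ≤ n

/-- The squares of the Ferrers board with column heights `c`. -/
def boardSq (n : ℕ) (c : Fin n → ℕ) : Finset (Fin n × Fin n) :=
  Finset.univ.filter fun s => (s.1 : ℕ) < c s.2

/-- A set of rooks is non-attacking when no two share a row or a column. -/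
def NonAttacking {n : ℕ} (C : Finset (Fin n × Fin n)) : Prop :=
  ∀ r ∈ C, ∀ r' ∈ C, r ≠ r' → r.1 ≠ r'.1 ∧ r.2 ≠ r'.2

/-- Placements of `k` non-attacking rooks on the Ferrers board. -/
def placements (n : ℕ) (c : Fin n → ℕ) (k : ℕ) : Finset (Finset (Fin n × Fin n)) :=
  Finset.univ.filter fun C => C.card = k ∧ C ⊆ boardSq n c ∧ NonAttacking C

/-- `inv(C,B)`: the number of squares of the board that do not contain a rook and
are not above (smaller row index, same column) nor to the right of (same row,
larger column index) any rook of `C`. -/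
def rookInv (n : ℕ) (c : Fin n → ℕ) (C : Finset (Fin n × Fin n)) : ℕ :=
  ((boardSq n c).filter fun s => s ∉ C ∧ ∀ r ∈ C,
    ¬(r.2 = s.2 ∧ s.1 < r.1) ∧ ¬(r.1 = s.1 ∧ r.2 < s.2)).card

/-- The Garsia–Remmel q-rook polynomial `R_k(B;q)`. -/
def qRook (q : R) (n : ℕ) (c : Fin n → ℕ) (k : ℕ) : R :=
  ∑ C ∈ placements n c k, q ^ rookInv n c C

/-- The polynomial (in `x`) `∑_{j=0}^n [j]_q! R_{n-j}(B;q) ∏_{i=j+1}^n (x - q^i)`. -/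
def hitGen (q : R) (n : ℕ) (c : Fin n → ℕ) : Polynomial R :=
  ∑ j ∈ Finset.range (n + 1),
    Polynomial.C (qfact q j * qRook q n c (n - j)) *
      ∏ i ∈ Finset.Icc (j + 1) n, (Polynomial.X - Polynomial.C (q ^ i))

/-- The Garsia–Remmel q-hit polynomial `T_k(B;q)`, defined by
`∑_{j=0}^n [j]_q! R_{n-j}(B;q) ∏_{i=j+1}^n (x - q^i) = ∑_k T_k(B;q) x^k`. -/
def qHit (q : R) (n : ℕ) (c : Fin n → ℕ) (k : ℕ) : R := (hitGen q n c).coeff k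

/-- Placements of `n` non-attacking rooks on the full `n × n` grid with exactly
`k` rooks on the board. -/
def fullPlacements (n : ℕ) (c : Fin n → ℕ) (k : ℕ) : Finset (Finset (Fin n × Fin n)) :=
  Finset.univ.filter fun C => C.card = n ∧ NonAttacking C ∧ (C ∩ boardSq n c).card = k

end

noncomputable section

/-- The descent set of a permutation of `Fin n` (0-based positions). -/
def descSet {n : ℕ} (σ : Equiv.Perm (Fin n)) : Finset (Fin n) :=
  Finset.univ.filter fun i => ∃ h : (i : ℕ) + 1 < n, σ ⟨(i : ℕ) + 1, h⟩ < σ i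

/-- The number of descents. -/
def desStat {n : ℕ} (σ : Equiv.Perm (Fin n)) : ℕ := (descSet σ).card

/-- The major index (descent positions counted 1-based). -/
def majStat {n : ℕ} (σ : Equiv.Perm (Fin n)) : ℕ := ∑ i ∈ descSet σ, ((i : ℕ) + 1)

end

section QAnalogues

variable {R : Type*} [CommRing R] (q : R)

lemma qint_succ (m : ℕ) : qint q (m + 1) = qint q m + q ^ m :=
  Finset.sum_range_succ _ _

lemma qint_succ' (m : ℕ) : qint q (m + 1) = q * qint q m + 1 :=
  geom_sum_succ

lemma qfact_succ (m : ℕ) : qfact q (m + 1) = qfact q m * qint q (m + 1) :=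
  Finset.prod_range_succ _ _

lemma sum_pow_card_gt {α : Type*} [LinearOrder α] (S : Finset α) :
    ∑ i ∈ S, q ^ (S.filter fun j => i < j).card = qint q S.card := by
  induction S using Finset.induction_on_min with
  | empty => simp [qint]
  | insert a s ha ih =>
    have has : a ∉ s := fun h => lt_irrefl _ (ha a h)
    rw [Finset.sum_insert has, Finset.card_insert_of_notMem has, qint_succ, ← ih, add_comm]
    congr 1
    · refine Finset.sum_congr rfl fun i hi => ?_
      rw [Finset.filter_insert, if_neg (ha i hi).not_gt]
    · rw [Finset.filter_insert, if_neg (lt_irrefl a), Finset.filter_true_of_mem ha]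

lemma sum_pow_card_lt {α : Type*} [LinearOrder α] (S : Finset α) :
    ∑ i ∈ S, q ^ (S.filter fun j => j < i).card = qint q S.card := by
  induction S using Finset.induction_on_max with
  | empty => simp [qint]
  | insert a s ha ih =>
    have has : a ∉ s := fun h => lt_irrefl _ (ha a h)
    rw [Finset.sum_insert has, Finset.card_insert_of_notMem has, qint_succ, ← ih, add_comm]
    congr 1
    · refine Finset.sum_congr rfl fun i hi => ?_
      rw [Finset.filter_insert, if_neg (ha i hi).not_gt]
    · rw [Finset.filter_insert, if_neg (lt_irrefl a), Finset.filter_true_of_mem ha]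

lemma sum_pow_of_mem (E : Finset ℕ) :
    ∑ p ∈ E, q ^ (E.filter fun e => p ≤ e).card = q * qint q E.card := by
  rw [← sum_pow_card_gt, Finset.mul_sum]
  refine Finset.sum_congr rfl fun p hp => ?_
  rw [← pow_succ']
  congr 1
  have : E.filter (fun e => p ≤ e) = insert p (E.filter fun e => p < e) := by
    ext e
    simp only [Finset.mem_filter, Finset.mem_insert]
    grind
  rw [this, Finset.card_insert_of_notMem (by simp)]

lemma sum_pow_of_notMem {N : ℕ} {E : Finset ℕ} (hE : E ⊆ Finset.range N) :
    ∑ p ∈ Finset.range N \ E, q ^ (p + 1 + (E.filter fun e => p < e).card) =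
      q ^ (E.card + 1) * qint q (N - E.card) := by
  have hcard : (Finset.range N \ E).card = N - E.card := by
    rw [Finset.card_sdiff_of_subset hE, Finset.card_range]
  rw [← hcard, ← sum_pow_card_lt, Finset.mul_sum]
  refine Finset.sum_congr rfl fun p hp => ?_
  rw [← pow_add]
  congr 1
  simp only [Finset.mem_sdiff, Finset.mem_range] at hp
  have h1 : (E.filter fun e => p < e).card + (E.filter fun e => e < p).card = E.card := by
    rw [← Finset.card_filter_add_card_filter_not (s := E) (fun e => p < e)]
    congr 2
    refine Finset.filter_congr fun e he => ?_
    have : e ≠ p := fun h => hp.2 (h ▸ he)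
    omega
  have h2 : (E.filter fun e => e < p).card +
      ((Finset.range N \ E).filter fun e => e < p).card = p := by
    rw [← Finset.card_union_of_disjoint]
    · conv_rhs => rw [← Finset.card_range p]
      congr 1
      ext e
      simp only [Finset.mem_union, Finset.mem_filter, Finset.mem_sdiff, Finset.mem_range]
      grind
    · rw [Finset.disjoint_left]
      simp only [Finset.mem_filter, Finset.mem_sdiff]
      tauto
  omega

end QAnalogues

section StepOperator

open Polynomial

variable {R : Type*} [CommRing R] (q : R)

/-- The linear operator `x^m ↦ [n-m]_q x^{m+1} + q^{n-m} [m+1]_q x^m`, which carries the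
`q`-hit polynomial of the staircase of size `n` to that of size `n + 1`. -/
noncomputable def hitStep (n : ℕ) : R[X] →ₗ[R] R[X] :=
  Polynomial.lsum fun m => LinearMap.toSpanSingleton R R[X]
    (C (qint q (n - m)) * X ^ (m + 1) + C (q ^ (n - m) * qint q (m + 1)) * X ^ m)

lemma hitStep_C_mul_X_pow (n m : ℕ) (a : R) :
    hitStep q n (C a * X ^ m) = C a *
      (C (qint q (n - m)) * X ^ (m + 1) + C (q ^ (n - m) * qint q (m + 1)) * X ^ m) := by
  rw [C_mul_X_pow_eq_monomial, hitStep, lsum_apply, sum_monomial_index _ _ (by simp),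
    LinearMap.toSpanSingleton_apply, smul_eq_C_mul]

lemma hitStep_C_mul (n : ℕ) (a : R) (f : R[X]) :
    hitStep q n (C a * f) = C a * hitStep q n f := by
  rw [← smul_eq_C_mul, map_smul, smul_eq_C_mul]

lemma hitStep_mul_X_sub_C (n : ℕ) (f : R[X]) (hf : f.natDegree ≤ n) :
    hitStep q (n + 1) (f * (X - C (q ^ (n + 1)))) =
      hitStep q n f * (X - C (q ^ (n + 2))) := by
  refine induction_with_natDegree_le
    (fun f => hitStep q (n + 1) (f * (X - C (q ^ (n + 1)))) =
      hitStep q n f * (X - C (q ^ (n + 2)))) n (by simp) ?_ ?_ f hf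
  · intro m a _ hm
    have h : C a * X ^ m * (X - C (q ^ (n + 1))) =
        C a * X ^ (m + 1) - C (a * q ^ (n + 1)) * X ^ m := by
      rw [C_mul]; ring
    rw [h, map_sub, hitStep_C_mul_X_pow, hitStep_C_mul_X_pow, hitStep_C_mul_X_pow]
    obtain ⟨d, rfl⟩ := Nat.exists_eq_add_of_le hm
    rw [show m + d + 1 - (m + 1) = d by omega, show m + d + 1 - m = d + 1 by omega,
      show m + d - m = d by omega, qint_succ' q d, qint_succ q (m + 1)]
    simp only [C_mul, C_add, C_pow, C_1]
    ring
  · intro f g _ _ hf hg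
    simp only [add_mul, map_add, hf, hg]

lemma hitStep_prod_X_sub_C {n j : ℕ} (hj : j ≤ n) :
    hitStep q n (∏ i ∈ Finset.Icc (j + 1) n, (X - C (q ^ i))) =
      C (qint q j) * ∏ i ∈ Finset.Icc (j + 1) (n + 1), (X - C (q ^ i)) +
        C (q ^ j * qint q (j + 1)) * ∏ i ∈ Finset.Icc (j + 2) (n + 1), (X - C (q ^ i)) := by
  have hdeg (n : ℕ) : (∏ i ∈ Finset.Icc (j + 1) n, (X - C (q ^ i))).natDegree ≤ n := by
    refine (natDegree_prod_le _ _).trans ?_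
    refine (Finset.sum_le_card_nsmul _ _ 1 fun i _ => ?_).trans (by simp)
    exact natDegree_X_sub_C_le _
  induction n, hj using Nat.le_induction with
  | base =>
    have h := hitStep_C_mul_X_pow q j 0 1
    simp only [C_1, one_mul, pow_zero, mul_one] at h
    have h1 : Finset.Icc (j + 1) j = ∅ := Finset.Icc_eq_empty (by omega)
    have h2 : Finset.Icc (j + 2) (j + 1) = ∅ := Finset.Icc_eq_empty (by omega)
    rw [h1, h2, Finset.prod_empty, h, Finset.Icc_self, Finset.prod_singleton, qint_succ' q j]
    simp [qint]
    ring
  | succ n hn ih =>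
    rw [Finset.prod_Icc_succ_top (a := j + 1) (b := n) (by omega), hitStep_mul_X_sub_C q n _ (hdeg n), ih,
      Finset.prod_Icc_succ_top (a := j + 1) (b := n + 1) (by omega),
      Finset.prod_Icc_succ_top (a := j + 2) (b := n + 1) (by omega)]
    ring

end StepOperator

section Insertion

variable {n : ℕ}

/-- Insert the new maximal value at position `p` of the word of `σ`. -/
def insertMax (p : Fin (n + 1)) (σ : Equiv.Perm (Fin n)) : Equiv.Perm (Fin (n + 1)) :=
  (finSuccEquiv' p).trans (σ.optionCongr.trans (finSuccEquiv' (Fin.last n)).symm)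

lemma insertMax_self (p : Fin (n + 1)) (σ : Equiv.Perm (Fin n)) :
    insertMax p σ p = Fin.last n := by
  simp [insertMax]

lemma insertMax_succAbove (p : Fin (n + 1)) (σ : Equiv.Perm (Fin n)) (i : Fin n) :
    insertMax p σ (p.succAbove i) = (σ i).castSucc := by
  simp [insertMax]

lemma insertMax_bijective :
    Function.Bijective fun x : Fin (n + 1) × Equiv.Perm (Fin n) => insertMax x.1 x.2 := by
  rw [Fintype.bijective_iff_injective_and_card]
  refine ⟨?_, by simp [Fintype.card_perm, Nat.factorial_succ]⟩
  rintro ⟨p, σ⟩ ⟨p', σ'⟩ h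
  simp only at h
  obtain rfl : p = p' := by
    apply (insertMax p σ).injective
    rw [insertMax_self, h, insertMax_self]
  refine Prod.ext rfl (Equiv.ext fun i => Fin.castSucc_injective _ ?_)
  rw [← insertMax_succAbove, h, insertMax_succAbove]

lemma insertMax_apply_lt (p : Fin (n + 1)) (σ : Equiv.Perm (Fin n)) {j : ℕ} (hj : j < p) :
    insertMax p σ ⟨j, hj.trans p.2⟩ = (σ ⟨j, by omega⟩).castSucc := by
  rw [← insertMax_succAbove p, Fin.succAbove_of_castSucc_lt _ _ (by simpa [Fin.lt_def] using hj)]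
  rfl

lemma insertMax_apply_gt (p : Fin (n + 1)) (σ : Equiv.Perm (Fin n)) {j : ℕ} (hj : p ≤ j)
    (hn : j < n) : insertMax p σ ⟨j + 1, by omega⟩ = (σ ⟨j, hn⟩).castSucc := by
  rw [← insertMax_succAbove p,
    Fin.succAbove_of_le_castSucc _ _ (by simpa [Fin.le_def] using hj)]
  rfl

lemma insertMax_apply_eq (p : Fin (n + 1)) (σ : Equiv.Perm (Fin n)) {j : ℕ} (hj : j = p) :
    insertMax p σ ⟨j, hj ▸ p.2⟩ = Fin.last n := by
  subst hj
  exact insertMax_self p σ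

/-- The descent positions of `σ`, counted from `1`. -/
noncomputable def descPos (σ : Equiv.Perm (Fin n)) : Finset ℕ :=
  (descSet σ).image fun i : Fin n => (i : ℕ) + 1

lemma mem_descPos {σ : Equiv.Perm (Fin n)} {e : ℕ} :
    e ∈ descPos σ ↔
      ∃ i, ∃ h : i + 1 < n, σ ⟨i + 1, h⟩ < σ ⟨i, by omega⟩ ∧ i + 1 = e := by
  simp only [descPos, descSet, Finset.mem_image, Finset.mem_filter, Finset.mem_univ, true_and]
  constructor
  · rintro ⟨i, ⟨h, hi⟩, rfl⟩
    exact ⟨i, h, hi, rfl⟩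
  · rintro ⟨i, h, hi, rfl⟩
    exact ⟨⟨i, by omega⟩, ⟨h, hi⟩, rfl⟩

lemma succ_mem_descPos {σ : Equiv.Perm (Fin n)} {i : ℕ} (h : i + 1 < n) :
    i + 1 ∈ descPos σ ↔ σ ⟨i + 1, h⟩ < σ ⟨i, by omega⟩ := by
  rw [mem_descPos]
  constructor
  · rintro ⟨j, hj, hlt, hji⟩
    obtain rfl : j = i := by omega
    exact hlt
  · exact fun hlt => ⟨i, h, hlt, rfl⟩

lemma pos_of_mem_descPos {σ : Equiv.Perm (Fin n)} {e : ℕ} (he : e ∈ descPos σ) : 0 < e := by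
  obtain ⟨i, _, _, rfl⟩ := mem_descPos.1 he
  omega

lemma lt_of_mem_descPos {σ : Equiv.Perm (Fin n)} {e : ℕ} (he : e ∈ descPos σ) : e < n := by
  obtain ⟨i, h, _, rfl⟩ := mem_descPos.1 he
  exact h

lemma card_descPos (σ : Equiv.Perm (Fin n)) : (descPos σ).card = desStat σ :=
  Finset.card_image_of_injective _ fun _ _ h => Fin.ext (Nat.succ_injective h)

lemma sum_descPos (σ : Equiv.Perm (Fin n)) : ∑ e ∈ descPos σ, e = majStat σ :=
  Finset.sum_image fun _ _ _ _ h => Fin.ext (Nat.succ_injective h)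

lemma desStat_lt (hn : 0 < n) (σ : Equiv.Perm (Fin n)) : desStat σ < n := by
  have h : descPos σ ⊆ Finset.Ico 1 n := fun e he =>
    Finset.mem_Ico.2 ⟨pos_of_mem_descPos he, lt_of_mem_descPos he⟩
  have := Finset.card_le_card h
  rw [card_descPos, Nat.card_Ico] at this
  omega

lemma descPos_insertMax (p : Fin (n + 1)) (σ : Equiv.Perm (Fin n)) :
    descPos (insertMax p σ) =
      ((descPos σ).filter (· < (p : ℕ)) ∪ ({(p : ℕ) + 1} : Finset ℕ).filter (· ≤ n)) ∪
        ((descPos σ).filter ((p : ℕ) < ·)).image (· + 1) := by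
  ext e
  simp only [Finset.mem_union, Finset.mem_filter, Finset.mem_singleton, Finset.mem_image]
  rcases e with _ | i
  · refine iff_of_false (fun h => (pos_of_mem_descPos h).ne rfl) ?_
    rintro ((⟨h, -⟩ | ⟨h, -⟩) | ⟨e, -, h⟩)
    · exact (pos_of_mem_descPos h).ne rfl
    · exact Nat.succ_ne_zero _ h.symm
    · exact Nat.succ_ne_zero _ h
  by_cases hin : i < n
  swap
  · refine iff_of_false (fun h => ?_) ?_
    · have := lt_of_mem_descPos h
      omega
    rintro ((⟨h, -⟩ | ⟨-, h⟩) | ⟨e, ⟨h, -⟩, h'⟩)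
    · have := lt_of_mem_descPos h
      omega
    · omega
    · have := lt_of_mem_descPos h
      omega
  rw [succ_mem_descPos (by omega)]
  rcases lt_trichotomy i p with hip | hip | hip
  · rcases Nat.lt_or_ge (i + 1) p with hip' | hip'
    · rw [insertMax_apply_lt p σ hip, insertMax_apply_lt p σ hip', Fin.castSucc_lt_castSucc_iff,
        ← succ_mem_descPos (σ := σ)]
      grind
    · obtain hip' : i + 1 = p := by omega
      rw [insertMax_apply_eq p σ hip']
      refine iff_of_false (Fin.le_last _).not_gt ?_
      grind
  · rw [insertMax_apply_eq p σ hip, insertMax_apply_gt p σ hip.ge hin]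
    refine iff_of_true (Fin.castSucc_lt_last _) ?_
    grind
  · obtain ⟨i, rfl⟩ : ∃ j, i = j + 1 := ⟨i - 1, by omega⟩
    rw [insertMax_apply_gt p σ hip.le hin, insertMax_apply_gt p σ (by omega) (by omega),
      Fin.castSucc_lt_castSucc_iff, ← succ_mem_descPos (σ := σ)]
    grind

lemma sum_descPos_insertMax (p : Fin (n + 1)) (σ : Equiv.Perm (Fin n)) (f : ℕ → ℕ) :
    ∑ e ∈ descPos (insertMax p σ), f e =
      ∑ e ∈ (descPos σ).filter (· < (p : ℕ)), f e + (if (p : ℕ) < n then f (p + 1) else 0) +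
        ∑ e ∈ (descPos σ).filter ((p : ℕ) < ·), f (e + 1) := by
  rw [descPos_insertMax, Finset.sum_union, Finset.sum_union, Finset.sum_image (by simp),
    Finset.sum_filter _ f, Finset.sum_filter (s := {(p : ℕ) + 1}), Finset.sum_singleton]
  · simp only [Finset.sum_filter, Nat.add_one_le_iff]
  · rw [Finset.disjoint_left]
    grind
  · rw [Finset.disjoint_left]
    grind

lemma sum_filter_lt_add_sum_filter_gt (E : Finset ℕ) (p : ℕ) (f : ℕ → ℕ) :
    ∑ e ∈ E.filter (· < p), f e + ∑ e ∈ E.filter (p < ·), f e = ∑ e ∈ E.erase p, f e := by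
  rw [← Finset.sum_union]
  · congr 1
    ext e
    simp only [Finset.mem_union, Finset.mem_filter, Finset.mem_erase]
    grind
  · rw [Finset.disjoint_left]
    grind

lemma desStat_insertMax (p : Fin (n + 1)) (σ : Equiv.Perm (Fin n)) :
    desStat (insertMax p σ) =
      ((descPos σ).erase p).card + if (p : ℕ) < n then 1 else 0 := by
  rw [← card_descPos, Finset.card_eq_sum_ones, sum_descPos_insertMax, Finset.card_eq_sum_ones,
    ← sum_filter_lt_add_sum_filter_gt]
  omega

lemma majStat_insertMax (p : Fin (n + 1)) (σ : Equiv.Perm (Fin n)) :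
    majStat (insertMax p σ) =
      ∑ e ∈ (descPos σ).erase p, e + (if (p : ℕ) < n then (p : ℕ) + 1 else 0) +
        ((descPos σ).filter ((p : ℕ) < ·)).card := by
  rw [← sum_descPos, sum_descPos_insertMax, Finset.sum_add_distrib, Finset.card_eq_sum_ones,
    ← sum_filter_lt_add_sum_filter_gt]
  omega

end Insertion

section Eulerian

open Polynomial

variable {R : Type*} [CommRing R] (q : R)

/-- The generating polynomial of `(maj, des)` over permutations of `Fin n`, with `x` marking
`n - 1 - des`. -/
noncomputable def eulerMahonian (n : ℕ) : R[X] :=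
  ∑ σ : Equiv.Perm (Fin n), C (q ^ majStat σ) * X ^ (n - 1 - desStat σ)

lemma sum_insertMax {n : ℕ} (hn : 0 < n) (σ : Equiv.Perm (Fin n)) :
    ∑ p : Fin (n + 1),
        C (q ^ majStat (insertMax p σ)) * X ^ (n - desStat (insertMax p σ)) =
      hitStep q n (C (q ^ majStat σ) * X ^ (n - 1 - desStat σ)) := by
  set E := descPos σ with hE
  set k := desStat σ with hk
  have hEk : E.card = k := card_descPos σ
  have hkn : k < n := desStat_lt hn σ
  have hEn : E ⊆ Finset.range n := fun e he => Finset.mem_range.2 (lt_of_mem_descPos he)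
  let F : ℕ → R[X] := fun p =>
    C (q ^ (∑ e ∈ E.erase p, e + (if p < n then p + 1 else 0) + (E.filter (p < ·)).card)) *
      X ^ (n - ((E.erase p).card + if p < n then 1 else 0))
  have hF : ∑ p : Fin (n + 1),
      C (q ^ majStat (insertMax p σ)) * X ^ (n - desStat (insertMax p σ)) =
        ∑ p ∈ Finset.range (n + 1), F p := by
    rw [Finset.sum_range]
    exact Finset.sum_congr rfl fun p _ => by rw [majStat_insertMax, desStat_insertMax]
  have hlast : F n = C (q ^ majStat σ) * X ^ (n - k) := by
    have hnE : n ∉ E := fun h => (Finset.mem_range.1 (hEn h)).false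
    have hempty : E.filter (n < ·) = ∅ := Finset.filter_false_of_mem fun e he =>
      (Finset.mem_range.1 (hEn he)).not_gt
    simp only [F, Finset.erase_eq_of_notMem hnE, hempty, lt_irrefl, if_false, hEk]
    rw [hE, sum_descPos]
    simp
  have hmem : ∑ p ∈ E, F p = C (q ^ majStat σ * (q * qint q k)) * X ^ (n - k) := by
    rw [← hEk, ← sum_pow_of_mem, Finset.mul_sum, map_sum, Finset.sum_mul]
    refine Finset.sum_congr rfl fun p hp => ?_
    have hpn := Finset.mem_range.1 (hEn hp)
    have hins : E.filter (p ≤ ·) = insert p (E.filter (p < ·)) := by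
      ext e
      simp only [Finset.mem_filter, Finset.mem_insert]
      grind
    have hsum := Finset.sum_erase_add E (fun e => e) hp
    have hcard := Finset.card_erase_add_one hp
    rw [← pow_add, ← sum_descPos, ← hE, ← hsum, hins, Finset.card_insert_of_notMem (by simp)]
    simp only [F, if_pos hpn, hcard]
    congr 3
    omega
  have hnotMem : ∑ p ∈ Finset.range n \ E, F p =
      C (q ^ majStat σ * (q ^ (k + 1) * qint q (n - k))) * X ^ (n - 1 - k) := by
    rw [← hEk, ← sum_pow_of_notMem q hEn, Finset.mul_sum, map_sum, Finset.sum_mul]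
    refine Finset.sum_congr rfl fun p hp => ?_
    obtain ⟨hpn, hpE⟩ := Finset.mem_sdiff.1 hp
    rw [← pow_add, ← sum_descPos, ← hE]
    simp only [F, if_pos (Finset.mem_range.1 hpn), Finset.erase_eq_of_notMem hpE]
    congr 2
    · rw [add_assoc]
    · omega
  rw [hF, Finset.sum_range_succ, ← Finset.sum_sdiff hEn, hlast, hmem, hnotMem,
    hitStep_C_mul_X_pow, show n - (n - 1 - k) = k + 1 by omega,
    show n - 1 - k + 1 = n - k by omega, qint_succ' q k]
  simp only [C_mul, C_add, C_1]
  ring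

lemma eulerMahonian_succ {n : ℕ} (hn : 0 < n) :
    eulerMahonian q (n + 1) = hitStep q n (eulerMahonian q n) := by
  rw [eulerMahonian, ← (insertMax_bijective (n := n)).sum_comp, Fintype.sum_prod_type_right,
    eulerMahonian, map_sum]
  exact Finset.sum_congr rfl fun σ _ => sum_insertMax q hn σ

lemma coeff_eulerMahonian {n k : ℕ} (hn : 0 < n) (hk : k ≤ n - 1) :
    (eulerMahonian q n).coeff (n - k - 1) =
      ∑ σ ∈ Finset.univ.filter (fun σ : Equiv.Perm (Fin n) => desStat σ = k),
        q ^ majStat σ := by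
  rw [eulerMahonian, finsetSum_coeff, Finset.sum_filter]
  refine Finset.sum_congr rfl fun σ _ => ?_
  have := desStat_lt hn σ
  rw [coeff_C_mul_X_pow]
  congr 1
  exact propext ⟨fun h => by omega, fun h => by omega⟩

end Eulerian

section Rook

variable {n : ℕ}

/-- The inclusion of the `n × n` grid into the `(n + 1) × (n + 1)` grid. -/
def liftSq (n : ℕ) : Fin n × Fin n ↪ Fin (n + 1) × Fin (n + 1) :=
  ⟨Prod.map Fin.castSucc Fin.castSucc,
    (Fin.castSucc_injective n).prodMap (Fin.castSucc_injective n)⟩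

/-- The inclusion of the rows of the `n × n` grid as squares of the last column of the
`(n + 1) × (n + 1)` grid. -/
def lastCol (n : ℕ) : Fin n ↪ Fin (n + 1) × Fin (n + 1) :=
  ⟨fun i => (i.castSucc, Fin.last n), fun _ _ h => Fin.castSucc_injective n (Prod.ext_iff.1 h).1⟩

lemma liftSq_apply (s : Fin n × Fin n) : liftSq n s = (s.1.castSucc, s.2.castSucc) := rfl

lemma lastCol_apply (i : Fin n) : lastCol n i = (i.castSucc, Fin.last n) := rfl

/-- The rows that contain no square of `C`. -/
def freeRows (C : Finset (Fin n × Fin n)) : Finset (Fin n) :=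
  Finset.univ.filter fun i => ∀ r ∈ C, r.1 ≠ i

/-- Add a rook in row `i` of the last column. -/
def addRook (i : Fin n) (C : Finset (Fin n × Fin n)) : Finset (Fin (n + 1) × Fin (n + 1)) :=
  insert (lastCol n i) (C.map (liftSq n))

lemma castSucc_mem_map_liftSq {C : Finset (Fin n × Fin n)} {a b : Fin n} :
    (a.castSucc, b.castSucc) ∈ C.map (liftSq n) ↔ (a, b) ∈ C :=
  Finset.mem_map' (liftSq n) (a := (a, b))

lemma last_notMem_map_liftSq (C : Finset (Fin n × Fin n)) (a : Fin (n + 1)) :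
    (a, Fin.last n) ∉ C.map (liftSq n) := by
  rw [Finset.mem_map]
  rintro ⟨⟨c, d⟩, -, h⟩
  exact Fin.castSucc_ne_last d (Prod.ext_iff.1 h).2

lemma last_row_notMem_map_liftSq (C : Finset (Fin n × Fin n)) (b : Fin (n + 1)) :
    (Fin.last n, b) ∉ C.map (liftSq n) := by
  rw [Finset.mem_map]
  rintro ⟨⟨c, d⟩, -, h⟩
  exact Fin.castSucc_ne_last c (Prod.ext_iff.1 h).1

lemma castSucc_mem_map_lastCol {S : Finset (Fin n)} {i : Fin n} :
    (i.castSucc, Fin.last n) ∈ S.map (lastCol n) ↔ i ∈ S :=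
  Finset.mem_map' (lastCol n)

lemma castSucc_notMem_map_lastCol (S : Finset (Fin n)) (a : Fin (n + 1)) (b : Fin n) :
    (a, b.castSucc) ∉ S.map (lastCol n) := by
  rw [Finset.mem_map]
  rintro ⟨i, -, h⟩
  exact Fin.castSucc_ne_last b (Prod.ext_iff.1 h).2.symm

lemma last_row_notMem_map_lastCol (S : Finset (Fin n)) (b : Fin (n + 1)) :
    (Fin.last n, b) ∉ S.map (lastCol n) := by
  rw [Finset.mem_map]
  rintro ⟨i, -, h⟩
  exact Fin.castSucc_ne_last i (Prod.ext_iff.1 h).1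

lemma lastCol_notMem_map_liftSq (C : Finset (Fin n × Fin n)) (i : Fin n) :
    lastCol n i ∉ C.map (liftSq n) :=
  last_notMem_map_liftSq C _

lemma card_addRook (i : Fin n) (C : Finset (Fin n × Fin n)) :
    (addRook i C).card = C.card + 1 := by
  rw [addRook, Finset.card_insert_of_notMem (lastCol_notMem_map_liftSq C i), Finset.card_map]

lemma card_freeRows {C : Finset (Fin n × Fin n)} (hC : NonAttacking C) :
    (freeRows C).card = n - C.card := by
  have h : freeRows C = (C.image Prod.fst)ᶜ := by
    ext i
    simp [freeRows]
    grind
  rw [h, Finset.card_compl, Fintype.card_fin, Finset.card_image_of_injOn]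
  intro r hr r' hr' hrr'
  by_contra hne
  exact (hC r hr r' hr' hne).1 hrr'

lemma card_le_of_nonAttacking {C : Finset (Fin n × Fin n)} (hC : NonAttacking C) :
    C.card ≤ n := by
  rw [← Finset.card_image_of_injOn (f := Prod.fst) (s := C)]
  · simpa using Finset.card_le_univ (C.image Prod.fst)
  · intro r hr r' hr' hrr'
    by_contra hne
    exact (hC r hr r' hr' hne).1 hrr'

lemma nonAttacking_map_liftSq {C : Finset (Fin n × Fin n)} :
    NonAttacking (C.map (liftSq n)) ↔ NonAttacking C := by
  simp [NonAttacking, -Finset.mem_map, -Prod.forall, Finset.forall_mem_map, liftSq_apply,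
    Prod.ext_iff]

lemma nonAttacking_addRook {C : Finset (Fin n × Fin n)} {i : Fin n} :
    NonAttacking (addRook i C) ↔ NonAttacking C ∧ i ∈ freeRows C := by
  constructor
  · intro h
    refine ⟨nonAttacking_map_liftSq.1 fun r hr r' hr' =>
      h r (Finset.mem_insert_of_mem hr) r' (Finset.mem_insert_of_mem hr'), ?_⟩
    refine Finset.mem_filter.2 ⟨Finset.mem_univ _, fun r hr hri => ?_⟩
    have hr' := Finset.mem_map_of_mem (liftSq n) hr
    refine (h _ (Finset.mem_insert_of_mem hr') _ (Finset.mem_insert_self _ _) ?_).1 ?_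
    · exact fun heq => lastCol_notMem_map_liftSq C i (heq ▸ hr')
    · rw [← hri]
      rfl
  · rintro ⟨hC, hi⟩
    have hi' := (Finset.mem_filter.1 hi).2
    have key : ∀ r ∈ C.map (liftSq n),
        r.1 ≠ (lastCol n i).1 ∧ r.2 ≠ (lastCol n i).2 := by
      intro r hr
      obtain ⟨s, hs, rfl⟩ := Finset.mem_map.1 hr
      exact ⟨fun h => hi' s hs (Fin.castSucc_injective n h), Fin.castSucc_ne_last s.2⟩
    intro r hr r' hr' hne
    rcases Finset.mem_insert.1 hr with rfl | hr <;> rcases Finset.mem_insert.1 hr' with rfl | hr'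
    · exact absurd rfl hne
    · exact ⟨(key r' hr').1.symm, (key r' hr').2.symm⟩
    · exact key r hr
    · exact nonAttacking_map_liftSq.2 hC r hr r' hr' hne

lemma map_liftSq_subset_boardSq {C : Finset (Fin n × Fin n)} :
    C.map (liftSq n) ⊆ boardSq (n + 1) (fun j => (j : ℕ)) ↔ C ⊆ boardSq n fun j => (j : ℕ) := by
  simp only [Finset.subset_iff, Finset.forall_mem_map, liftSq_apply]
  simp [boardSq]

lemma addRook_subset_boardSq {C : Finset (Fin n × Fin n)} {i : Fin n} :
    addRook i C ⊆ boardSq (n + 1) (fun j => (j : ℕ)) ↔ C ⊆ boardSq n fun j => (j : ℕ) := by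
  rw [addRook, Finset.insert_subset_iff, map_liftSq_subset_boardSq]
  simp [boardSq, lastCol_apply]

lemma map_liftSq_mem_placements {C : Finset (Fin n × Fin n)} {k : ℕ} :
    C.map (liftSq n) ∈ placements (n + 1) (fun j => (j : ℕ)) k ↔
      C ∈ placements n (fun j => (j : ℕ)) k := by
  simp [placements, nonAttacking_map_liftSq, map_liftSq_subset_boardSq]

lemma addRook_mem_placements {C : Finset (Fin n × Fin n)} {i : Fin n} {k : ℕ} :
    addRook i C ∈ placements (n + 1) (fun j => (j : ℕ)) (k + 1) ↔
      C ∈ placements n (fun j => (j : ℕ)) k ∧ i ∈ freeRows C := by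
  simp [placements, nonAttacking_addRook, addRook_subset_boardSq, card_addRook, and_assoc]

lemma eq_map_liftSq_or_eq_addRook {C : Finset (Fin (n + 1) × Fin (n + 1))}
    (hB : C ⊆ boardSq (n + 1) fun j => (j : ℕ)) (hC : NonAttacking C) :
    ∃ D : Finset (Fin n × Fin n), C = D.map (liftSq n) ∨ ∃ i, C = addRook i D := by
  refine ⟨Finset.univ.filter fun s => liftSq n s ∈ C, ?_⟩
  have hlt : ∀ a b, (a, b) ∈ C → a < b := fun a b h => (Finset.mem_filter.1 (hB h)).2
  have hD (a b : Fin n) : (a.castSucc, b.castSucc) ∈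
      (Finset.univ.filter fun s => liftSq n s ∈ C).map (liftSq n) ↔
        (a.castSucc, b.castSucc) ∈ C := by
    rw [castSucc_mem_map_liftSq, Finset.mem_filter]
    exact and_iff_right (Finset.mem_univ _)
  by_cases h : ∃ i : Fin n, lastCol n i ∈ C
  · obtain ⟨i, hi⟩ := h
    refine Or.inr ⟨i, ?_⟩
    ext ⟨a, b⟩
    rw [addRook, Finset.mem_insert]
    induction b using Fin.lastCases with
    | last =>
      rw [or_iff_left (last_notMem_map_liftSq _ a)]
      refine ⟨fun hab => ?_, fun hab => hab ▸ hi⟩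
      by_contra hne
      exact (hC _ hab _ hi hne).2 rfl
    | cast b =>
      rw [or_iff_right fun h => Fin.castSucc_ne_last b (Prod.ext_iff.1 h).2]
      induction a using Fin.lastCases with
      | last =>
        exact iff_of_false (fun h => (hlt _ _ h).not_ge (Fin.le_last _))
          (last_row_notMem_map_liftSq _ _)
      | cast a => exact (hD a b).symm
  · refine Or.inl ?_
    ext ⟨a, b⟩
    induction b using Fin.lastCases with
    | last =>
      refine iff_of_false (fun hab => h ?_) (last_notMem_map_liftSq _ a)
      exact ⟨a.castPred (hlt _ _ hab).ne, by simpa [lastCol_apply] using hab⟩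
    | cast b =>
      induction a using Fin.lastCases with
      | last =>
        exact iff_of_false (fun h => (hlt _ _ h).not_ge (Fin.le_last _))
          (last_row_notMem_map_liftSq _ _)
      | cast a => exact (hD a b).symm

lemma placements_succ (k : ℕ) :
    placements (n + 1) (fun j => (j : ℕ)) (k + 1) =
      (placements n (fun j => (j : ℕ)) (k + 1)).image (fun C => C.map (liftSq n)) ∪
        ((placements n (fun j => (j : ℕ)) k).sigma freeRows).image fun x => addRook x.2 x.1 := by
  ext C
  simp only [Finset.mem_union, Finset.mem_image, Finset.mem_sigma]
  constructor
  · intro h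
    obtain ⟨-, hB, hC⟩ := (Finset.mem_filter.1 h).2
    obtain ⟨D, rfl | ⟨i, rfl⟩⟩ := eq_map_liftSq_or_eq_addRook hB hC
    · exact Or.inl ⟨D, map_liftSq_mem_placements.1 h, rfl⟩
    · exact Or.inr ⟨⟨D, i⟩, addRook_mem_placements.1 h, rfl⟩
  · rintro (⟨D, hD, rfl⟩ | ⟨x, hx, rfl⟩)
    · exact map_liftSq_mem_placements.2 hD
    · exact addRook_mem_placements.2 hx

lemma addRook_injective :
    Function.Injective fun x : (_ : Finset (Fin n × Fin n)) × Fin n => addRook x.2 x.1 := by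
  rintro ⟨C, i⟩ ⟨D, j⟩ h
  simp only at h
  have hi : lastCol n i ∈ addRook j D := h ▸ Finset.mem_insert_self _ _
  obtain rfl : i = j := (lastCol n).injective
    ((Finset.mem_insert.1 hi).resolve_right (lastCol_notMem_map_liftSq D i))
  have hCD : C.map (liftSq n) = D.map (liftSq n) := by
    have := congrArg (fun S => S.erase (lastCol n i)) h
    simpa only [addRook, Finset.erase_insert (lastCol_notMem_map_liftSq _ i)] using this
  rw [Finset.map_injective _ hCD]

lemma rookInv_map_liftSq (C : Finset (Fin n × Fin n)) :
    rookInv (n + 1) (fun j => (j : ℕ)) (C.map (liftSq n)) =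
      rookInv n (fun j => (j : ℕ)) C + (freeRows C).card := by
  have hlast (j : Fin n) : ¬ Fin.last n < j.castSucc := (Fin.le_last _).not_gt
  rw [rookInv, rookInv, ← Finset.card_map (liftSq n), ← Finset.card_map (lastCol n),
    ← Finset.card_union_of_disjoint]
  · congr 1
    ext ⟨a, b⟩
    induction b using Fin.lastCases <;> induction a using Fin.lastCases <;>
      simp [-Finset.mem_map, -Prod.forall, boardSq, freeRows, Finset.forall_mem_map,
        liftSq_apply, hlast, castSucc_mem_map_liftSq, last_notMem_map_liftSq,
        last_row_notMem_map_liftSq, castSucc_mem_map_lastCol, castSucc_notMem_map_lastCol,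
        last_row_notMem_map_lastCol]
  · rw [Finset.disjoint_right]
    intro s hs
    obtain ⟨i, -, rfl⟩ := Finset.mem_map.1 hs
    exact lastCol_notMem_map_liftSq _ i

lemma rookInv_addRook (C : Finset (Fin n × Fin n)) (i : Fin n) :
    rookInv (n + 1) (fun j => (j : ℕ)) (addRook i C) =
      rookInv n (fun j => (j : ℕ)) C + ((freeRows C).filter fun j => i < j).card := by
  have hlast (j : Fin n) : ¬ Fin.last n < j.castSucc := (Fin.le_last _).not_gt
  have hne (j : Fin n) : Fin.last n ≠ j.castSucc := (Fin.castSucc_ne_last j).symm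
  rw [rookInv, rookInv, ← Finset.card_map (liftSq n), ← Finset.card_map (lastCol n),
    ← Finset.card_union_of_disjoint]
  · congr 1
    ext ⟨a, b⟩
    induction b using Fin.lastCases <;> induction a using Fin.lastCases <;>
      simp [-Finset.mem_map, -Prod.forall, boardSq, freeRows, addRook, Finset.forall_mem_map,
        liftSq_apply, lastCol_apply, hlast, hne, Fin.le_last, castSucc_mem_map_liftSq, last_notMem_map_liftSq,
        last_row_notMem_map_liftSq, castSucc_mem_map_lastCol, castSucc_notMem_map_lastCol,
        last_row_notMem_map_lastCol]
    rw [lt_iff_le_and_ne]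
    tauto
  · rw [Finset.disjoint_right]
    intro s hs
    obtain ⟨i, -, rfl⟩ := Finset.mem_map.1 hs
    exact lastCol_notMem_map_liftSq _ i

variable {R : Type*} [CommRing R] (q : R)

lemma qRook_eq_zero {c : Fin n → ℕ} {k : ℕ} (hk : n < k) : qRook q n c k = 0 := by
  rw [qRook, placements, Finset.filter_false_of_mem, Finset.sum_empty]
  rintro C - ⟨hcard, -, hC⟩
  have := card_le_of_nonAttacking hC
  omega

lemma qRook_zero (c : Fin n → ℕ) : qRook q n c 0 = q ^ rookInv n c ∅ := by
  have h : placements n c 0 = {∅} := by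
    ext C
    simp only [placements, Finset.mem_filter, Finset.mem_univ, true_and, Finset.card_eq_zero,
      Finset.mem_singleton, and_iff_left_iff_imp]
    rintro rfl
    simp [NonAttacking]
  rw [qRook, h, Finset.sum_singleton]

lemma qRook_succ_zero :
    qRook q (n + 1) (fun j => (j : ℕ)) 0 = q ^ n * qRook q n (fun j => (j : ℕ)) 0 := by
  have h := rookInv_map_liftSq (∅ : Finset (Fin n × Fin n))
  rw [Finset.map_empty, card_freeRows (by simp [NonAttacking])] at h
  rw [qRook_zero, qRook_zero, h, pow_add, mul_comm]
  simp

lemma qRook_succ_succ (k : ℕ) :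
    qRook q (n + 1) (fun j => (j : ℕ)) (k + 1) =
      q ^ (n - (k + 1)) * qRook q n (fun j => (j : ℕ)) (k + 1) +
        qint q (n - k) * qRook q n (fun j => (j : ℕ)) k := by
  rw [qRook, placements_succ, Finset.sum_union,
    Finset.sum_image ((Finset.map_injective (liftSq n)).injOn),
    Finset.sum_image addRook_injective.injOn, Finset.sum_sigma, qRook, qRook, Finset.mul_sum,
    Finset.mul_sum]
  · congr 1 <;> refine Finset.sum_congr rfl fun C hC => ?_ <;>
      obtain ⟨hcard, -, hC⟩ := (Finset.mem_filter.1 hC).2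
    · rw [rookInv_map_liftSq, card_freeRows hC, hcard, pow_add, mul_comm]
    · rw [← hcard, ← card_freeRows hC, ← sum_pow_card_gt, Finset.sum_mul]
      refine Finset.sum_congr rfl fun i _ => ?_
      rw [rookInv_addRook, pow_add, mul_comm]
  · rw [Finset.disjoint_right]
    intro S hS hS'
    obtain ⟨⟨C, i⟩, -, rfl⟩ := Finset.mem_image.1 hS
    obtain ⟨D, -, h⟩ := Finset.mem_image.1 hS'
    exact lastCol_notMem_map_liftSq D i (h ▸ Finset.mem_insert_self _ _)

end Rook

section Hit

open Polynomial

variable {R : Type*} [CommRing R] (q : R)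

lemma hitGen_succ (n : ℕ) :
    hitGen q (n + 1) (fun j => (j : ℕ)) = hitStep q n (hitGen q n fun j => (j : ℕ)) := by
  set r : ℕ → R := qRook q n fun j => (j : ℕ) with hr
  set P : ℕ → R[X] := fun j => ∏ i ∈ Finset.Icc (j + 1) (n + 1), (X - C (q ^ i)) with hP
  have hstep : hitStep q n (hitGen q n fun j => (j : ℕ)) =
      ∑ j ∈ Finset.range (n + 1), C (qfact q j * r (n - j) * qint q j) * P j +
        ∑ j ∈ Finset.range (n + 1), C (qfact q (j + 1) * (q ^ j * r (n - j))) * P (j + 1) := by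
    rw [hitGen, map_sum, ← Finset.sum_add_distrib]
    refine Finset.sum_congr rfl fun j hj => ?_
    rw [hitStep_C_mul, hitStep_prod_X_sub_C q (Nat.lt_succ_iff.1 (Finset.mem_range.1 hj)),
      qfact_succ]
    simp only [hP, C_mul]
    ring
  have hsecond : ∑ j ∈ Finset.range (n + 1), C (qfact q j * (q ^ (j - 1) * r (n + 1 - j))) * P j =
      ∑ j ∈ Finset.range n, C (qfact q (j + 1) * (q ^ j * r (n - j))) * P (j + 1) := by
    rw [Finset.sum_range_succ']
    have h0 : r (n + 1) = 0 := qRook_eq_zero q (Nat.lt_succ_self n)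
    simp [h0]
  rw [hstep, Finset.sum_range_succ
      (fun j => C (qfact q (j + 1) * (q ^ j * r (n - j))) * P (j + 1)), ← hsecond, ← add_assoc, ← Finset.sum_add_distrib,
    hitGen, Finset.sum_range_succ, Nat.sub_self, qRook_succ_zero, Nat.sub_self]
  congr 1
  refine Finset.sum_congr rfl fun j hj => ?_
  have hj := Finset.mem_range.1 hj
  rw [show n + 1 - j = n - j + 1 by omega, qRook_succ_succ, show n - (n - j + 1) = j - 1 by omega,
    show n - (n - j) = j by omega]
  simp only [hP, hr, C_mul, C_add]
  ring

lemma hitGen_zero (c : Fin 0 → ℕ) : hitGen q 0 c = 1 := by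
  simp [hitGen, qfact, qRook_zero, rookInv, boardSq]

lemma hitGen_eq_eulerMahonian {n : ℕ} (hn : 0 < n) :
    hitGen q n (fun j => (j : ℕ)) = eulerMahonian q n := by
  induction n, hn using Nat.le_induction with
  | base =>
    have h := hitStep_C_mul_X_pow q 0 0 1
    simp only [C_1, pow_zero, one_mul] at h
    have hmaj (σ : Equiv.Perm (Fin 1)) : majStat σ = 0 := by
      rw [← sum_descPos, Finset.sum_eq_zero_iff]
      intro e he
      exact Nat.lt_one_iff.1 (lt_of_mem_descPos he)
    rw [hitGen_succ, hitGen_zero, h, eulerMahonian, Fintype.sum_unique, hmaj]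
    simp [qint]
  | succ n hn ih => rw [hitGen_succ, ih, eulerMahonian_succ q hn]

end Hit

theorem statement11 {R : Type*} [CommRing R] (q : R) (n : ℕ) (hn : 1 ≤ n) (k : ℕ)
    (hk : k ≤ n - 1) :
    ∑ σ ∈ Finset.univ.filter (fun σ : Equiv.Perm (Fin n) => desStat σ = k),
        q ^ majStat σ =
      qHit q n (fun j => (j : ℕ)) (n - k - 1) := by
  rw [qHit, hitGen_eq_eulerMahonian q hn, coeff_eulerMahonian q hn hk]
end

section
/- Denert's statistic from ξ: for σ ∈ S_n, define den(σ) = #{1≤i<j≤n : σ_i ≤ j < σ_j} + #{1≤i<j≤n : σ_i > σ_j > j} + #{1≤i<j≤n : j ≥ σ_i > σ_j}. Then the pair (exc, den) is equidistributed with (des, maj) on S_n; that is, Σ_{σ∈S_n} p^{exc(σ)} q^{den(σ)} = Σ_{σ∈S_n} p^{des(σ)} q^{maj(σ)}, where exc(σ) = #{i : σ_i > i}. -/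
open Finset
open scoped Classical

noncomputable section

/-- The number of excedences of a permutation (1-based: `σ_i > i`). -/
def excStat {n : ℕ} (σ : Equiv.Perm (Fin n)) : ℕ :=
  (Finset.univ.filter fun i : Fin n => i < σ i).card

/-- Denert's statistic. -/
def denStat {n : ℕ} (σ : Equiv.Perm (Fin n)) : ℕ :=
  (Finset.univ.filter fun p : Fin n × Fin n =>
      p.1 < p.2 ∧ (σ p.1 : ℕ) ≤ (p.2 : ℕ) ∧ p.2 < σ p.2).card +
    (Finset.univ.filter fun p : Fin n × Fin n =>
      p.1 < p.2 ∧ σ p.2 < σ p.1 ∧ p.2 < σ p.2).card +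
    (Finset.univ.filter fun p : Fin n × Fin n =>
      p.1 < p.2 ∧ (σ p.1 : ℕ) ≤ (p.2 : ℕ) ∧ σ p.2 < σ p.1).card

end

/-- Inserting a letter into a permutation `σ` of `Fin n` at each of the `n + 1` positions `y` in
turn, when the effect on a pair of statistics is governed by a set of naturals below `n`. -/
theorem sum_insertion_range {M : Type*} [AddCommMonoid M] (n : ℕ) :
    ∀ (F : Finset ℕ), (∀ f ∈ F, f < n) → ∀ g₀ g₁ : ℕ → M,
    ∑ y ∈ range n, (if y ∈ F then g₀ (#{f ∈ F | y ≤ f}) else g₁ (#{f ∈ F | y ≤ f} + (y + 1))) =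
      ∑ s ∈ range #F, g₀ (s + 1) + ∑ s ∈ Ico #F n, g₁ (s + 1) := by
  induction n with
  | zero =>
    intro F hF g₀ g₁
    have : F = ∅ := by
      apply Finset.eq_empty_of_forall_notMem
      intro f hf
      exact absurd (hF f hf) (by omega)
    subst this
    simp
  | succ n ih =>
    intro F hF g₀ g₁
    rw [sum_range_succ]
    by_cases hn : n ∈ F
    · set G := F.erase n with hG
      have hFG : F = insert n G := (insert_erase hn).symm
      have hnG : n ∉ G := by simp [hG]
      have hGlt : ∀ f ∈ G, f < n := by
        intro f hf
        have h1 := hF f (mem_of_mem_erase hf)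
        have h2 : f ≠ n := ne_of_mem_erase hf
        omega
      have hcard : #F = #G + 1 := by rw [hFG, card_insert_of_notMem hnG]
      have hfil : ∀ y ≤ n, #{f ∈ F | y ≤ f} = #{f ∈ G | y ≤ f} + 1 := by
        intro y hy
        rw [hFG, filter_insert, if_pos hy, card_insert_of_notMem (by simp [hnG])]
      have hlast : #{f ∈ G | n ≤ f} = 0 := by
        rw [card_eq_zero, filter_eq_empty_iff]
        intro f hf
        have := hGlt f hf
        omega
      have key := ih G hGlt (fun s => g₀ (s + 1)) (fun s => g₁ (s + 1))
      rw [if_pos hn, hfil n le_rfl, hlast, hcard, sum_range_succ']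
      have h1 : ∑ y ∈ range n, (if y ∈ F then g₀ (#{f ∈ F | y ≤ f})
            else g₁ (#{f ∈ F | y ≤ f} + (y + 1))) =
          ∑ y ∈ range n, (if y ∈ G then g₀ (#{f ∈ G | y ≤ f} + 1)
            else g₁ (#{f ∈ G | y ≤ f} + (y + 1) + 1)) := by
        refine sum_congr rfl fun y hy => ?_
        have hy' := mem_range.1 hy
        rw [hfil y hy'.le]
        have : y ∈ F ↔ y ∈ G := by
          rw [hFG, mem_insert]
          constructor
          · rintro (h | h)
            · omega
            · exact h
          · exact Or.inr
        simp only [this]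
        congr 2
        ring
      rw [h1, key, ← Finset.sum_Ico_add' (fun s => g₁ (s + 1))]
      simp only [zero_add]
      abel
    · have hFlt : ∀ f ∈ F, f < n := by
        intro f hf
        have h1 := hF f hf
        have h2 : f ≠ n := fun h => hn (h ▸ hf)
        omega
      have hlast : #{f ∈ F | n ≤ f} = 0 := by
        rw [card_eq_zero, filter_eq_empty_iff]
        intro f hf
        have := hFlt f hf
        omega
      have hle : #F ≤ n := by
        have : F ⊆ range n := fun f hf => mem_range.2 (hFlt f hf)
        simpa using card_le_card this
      rw [if_neg hn, ih F hFlt, hlast, Finset.sum_Ico_succ_top hle, zero_add, add_assoc]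

theorem sum_perm_succ_of_insertion {M : Type*} [AddCommMonoid M] {n : ℕ}
    (ins : Equiv.Perm (Fin n) → Fin (n + 1) → Equiv.Perm (Fin (n + 1)))
    (hins : Function.Injective (Function.uncurry ins))
    (F : Equiv.Perm (Fin n) → Finset ℕ) (hF : ∀ σ, ∀ f ∈ F σ, f < n)
    (e d : Equiv.Perm (Fin n) → ℕ) (e' d' : Equiv.Perm (Fin (n + 1)) → ℕ)
    (he : ∀ σ, e σ = #(F σ))
    (he' : ∀ σ y, e' (ins σ y) = e σ + if (y : ℕ) ∈ F σ ∨ (y : ℕ) = n then 0 else 1)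
    (hd' : ∀ σ y, d' (ins σ y) = d σ + #{f ∈ F σ | (y : ℕ) ≤ f} +
      if (y : ℕ) ∈ F σ ∨ (y : ℕ) = n then 0 else (y : ℕ) + 1)
    (f : ℕ → ℕ → M) :
    ∑ τ, f (e' τ) (d' τ) = ∑ σ, (∑ s ∈ range (e σ), f (e σ) (d σ + (s + 1)) +
      ∑ s ∈ Ico (e σ) n, f (e σ + 1) (d σ + (s + 1)) + f (e σ) (d σ)) := by
  have hbij : Function.Bijective (Function.uncurry ins) := by
    rw [Fintype.bijective_iff_injective_and_card]
    refine ⟨hins, ?_⟩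
    rw [Fintype.card_prod, Fintype.card_perm, Fintype.card_perm, Fintype.card_fin,
      Fintype.card_fin, Nat.factorial_succ, mul_comm]
  rw [← (Equiv.ofBijective _ hbij).sum_comp, Fintype.sum_prod_type]
  refine sum_congr rfl fun σ _ => ?_
  simp only [Equiv.ofBijective_apply, Function.uncurry_apply_pair, he', hd']
  rw [Fin.sum_univ_castSucc]
  congr 1
  · have := sum_insertion_range n (F σ) (hF σ) (fun s => f (e σ) (d σ + s))
      (fun s => f (e σ + 1) (d σ + s))
    rw [he σ] at this ⊢
    rw [← this, ← Fin.sum_univ_eq_sum_range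
      (fun y => if y ∈ F σ then f #(F σ) (d σ + #{f ∈ F σ | y ≤ f})
        else f (#(F σ) + 1) (d σ + (#{f ∈ F σ | y ≤ f} + (y + 1))))]
    refine sum_congr rfl fun y _ => ?_
    have hy : ¬ (y : ℕ) = n := by omega
    by_cases h : (y : ℕ) ∈ F σ <;> simp [h, hy, add_assoc]
  · have : #{f ∈ F σ | n ≤ f} = 0 := by
      rw [card_eq_zero, filter_eq_empty_iff]
      intro f hf
      have := hF σ f hf
      omega
    simp [this]

theorem card_le_apply_lt_eq_card_lt_le_apply {n : ℕ} (σ : Equiv.Perm (Fin n)) (y : ℕ) :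
    #{i : Fin n | y ≤ (i : ℕ) ∧ (σ i : ℕ) < y} = #{i : Fin n | (i : ℕ) < y ∧ y ≤ (σ i : ℕ)} := by
  have h1 : #{i : Fin n | (σ i : ℕ) < y} = #{i : Fin n | (i : ℕ) < y} :=
    card_equiv σ (by simp)
  have h2 := card_filter_add_card_filter_not (s := ({i : Fin n | (σ i : ℕ) < y} : Finset _))
    (fun i => (i : ℕ) < y)
  have h3 := card_filter_add_card_filter_not (s := ({i : Fin n | (i : ℕ) < y} : Finset _))
    (fun i => (σ i : ℕ) < y)
  simp only [filter_filter, not_lt] at h2 h3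
  have h4 : #{i : Fin n | y ≤ (i : ℕ) ∧ (σ i : ℕ) < y} =
    #{i : Fin n | (σ i : ℕ) < y ∧ y ≤ (i : ℕ)} := by simp only [and_comm]
  have h5 : #{i : Fin n | (i : ℕ) < y ∧ (σ i : ℕ) < y} =
    #{i : Fin n | (σ i : ℕ) < y ∧ (i : ℕ) < y} := by simp only [and_comm]
  omega

theorem card_excedance_pairs {n : ℕ} (σ : Equiv.Perm (Fin n)) :
    #{p : Fin n × Fin n | p.1 < σ p.1 ∧ p.2 ≤ p.1 ∧ p.1 < σ p.2} =
      #{p : Fin n × Fin n | p.1 < σ p.1 ∧ p.2 < σ p.1 ∧ σ p.1 ≤ σ p.2} := by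
  refine card_nbij' (fun p => if σ p.2 < σ p.1 then p.swap else p)
    (fun p => if p.1 < p.2 then p.swap else p) ?_ ?_ ?_ ?_
  all_goals
    rintro ⟨e, i⟩ h
    simp only [coe_filter, mem_univ, true_and, Set.mem_ofPred_eq] at h ⊢
    split_ifs with h1 <;> simp only [Prod.swap] at *
  · exact ⟨by order, by order, by order⟩
  · exact ⟨by order, by order, by order⟩
  · exact ⟨by order, by order, by order⟩
  · exact ⟨by order, by order, by order⟩
  · have : i ≠ e := by rintro rfl; order
    exfalso; order
  · exfalso; order
  · have : σ i ≠ σ e := by rw [σ.injective.ne_iff]; order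
    exfalso; order
  · exfalso; order

/-- The contribution of position `i` to Denert's statistic in its decomposition along excedances
and non-excedances. -/
def denWeight {n : ℕ} (σ : Equiv.Perm (Fin n)) (i : Fin n) : ℕ :=
  if i < σ i then (i : ℕ) + 1 + #{l : Fin n | l < i ∧ σ i < σ l}
  else #{l : Fin n | i < l ∧ σ l < σ i}

theorem card_filter_prod_eq_sum {α β : Type*} [Fintype α] [Fintype β] (P : α × β → Prop)
    [DecidablePred P] : #{p : α × β | P p} = ∑ a, #{b : β | P (a, b)} := by
  simp only [card_filter, Fintype.sum_prod_type]

theorem denStat_eq_sum_denWeight {n : ℕ} (σ : Equiv.Perm (Fin n)) :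
    denStat σ = ∑ i, denWeight σ i := by
  have swap : ∀ (P : Fin n × Fin n → Prop) [DecidablePred P],
      #{p | P p} = #{p : Fin n × Fin n | P p.swap} := by
    intro P _
    exact card_equiv (Equiv.prodComm _ _) (by simp)
  have key := card_excedance_pairs σ
  unfold denStat
  rw [swap, swap fun p : Fin n × Fin n => p.1 < p.2 ∧ σ p.2 < σ p.1 ∧ p.2 < σ p.2]
  rw [card_filter_prod_eq_sum, card_filter_prod_eq_sum] at key
  rw [card_filter_prod_eq_sum, card_filter_prod_eq_sum, card_filter_prod_eq_sum]
  apply Nat.add_right_cancel (m := ∑ e, #{i : Fin n | e < σ e ∧ i ≤ e ∧ e < σ i})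
  conv_rhs => rw [key]
  rw [← sum_add_distrib, ← sum_add_distrib, ← sum_add_distrib, ← sum_add_distrib]
  refine sum_congr rfl fun e _ => ?_
  unfold denWeight
  by_cases he : e < σ e
  · have h1 : #{i : Fin n | i < e ∧ (σ i : ℕ) ≤ e ∧ e < σ e} +
        #{i : Fin n | e < σ e ∧ i ≤ e ∧ e < σ i} = e + 1 := by
      have h := card_filter_add_card_filter_not (s := Finset.Iic e) (fun i => σ i ≤ e)
      rw [Fin.card_Iic] at h
      rw [← h]
      congr 2
      · ext i
        simp only [mem_filter, mem_univ, true_and, mem_Iic, he, and_true, Fin.val_fin_le]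
        constructor
        · rintro ⟨h1, h2⟩; exact ⟨h1.le, h2⟩
        · rintro ⟨h1, h2⟩
          refine ⟨lt_of_le_of_ne h1 ?_, h2⟩
          rintro rfl
          order
      · ext i
        simp [he]
    have h2 : #{j : Fin n | e < j ∧ (σ e : ℕ) ≤ j ∧ σ j < σ e} =
        #{i : Fin n | e < σ e ∧ i < σ e ∧ σ e ≤ σ i} := by
      have h := card_le_apply_lt_eq_card_lt_le_apply σ (σ e)
      simp only [Fin.val_fin_le, Fin.val_fin_lt] at h ⊢
      simp only [he, true_and, ← h]
      congr 1
      ext j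
      simp only [mem_filter, mem_univ, true_and, and_iff_right_iff_imp]
      rintro ⟨h1, -⟩
      order
    have h3 : #{i : Fin n | i < e ∧ σ e < σ i ∧ e < σ e} = #{l : Fin n | l < e ∧ σ e < σ l} := by
      simp [he]
    simp only [Prod.swap, Fin.val_fin_le] at *
    rw [if_pos he]
    omega
  · have h3 : #{j : Fin n | e < j ∧ (σ e : ℕ) ≤ j ∧ σ j < σ e} =
        #{l : Fin n | e < l ∧ σ l < σ e} := by
      congr 1
      ext j
      simp only [mem_filter, mem_univ, true_and, Fin.val_fin_le]
      constructor
      · rintro ⟨h1, h2, h3⟩; exact ⟨h1, h3⟩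
      · rintro ⟨h1, h3⟩; exact ⟨h1, by order, h3⟩
    rw [if_neg he]
    simp only [Prod.swap, Fin.val_fin_le] at *
    simp [he, h3]

/-- The permutation of `Fin (n + 1)` whose word is obtained by inserting the letter `x` at
position `y` into the word `b`. -/
noncomputable def insertPerm {n : ℕ} (y x : Fin (n + 1)) (b : Fin n → Fin (n + 1))
    (hb : Function.Injective b) (hx : ∀ i, b i ≠ x) : Equiv.Perm (Fin (n + 1)) :=
  Equiv.ofBijective (Fin.insertNth (α := fun _ => Fin (n + 1)) y x b) <| by
    rw [← Finite.injective_iff_bijective]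
    intro j k h
    rcases Fin.eq_self_or_eq_succAbove y j with hj | ⟨i, hj⟩ <;>
      rcases Fin.eq_self_or_eq_succAbove y k with hk | ⟨l, hk⟩ <;>
      simp only [hj, hk, Fin.insertNth_apply_same, Fin.insertNth_apply_succAbove] at h ⊢
    · exact absurd h.symm (hx l)
    · exact absurd h (hx i)
    · rw [hb h]

@[simp]
theorem insertPerm_apply_self {n : ℕ} (y x : Fin (n + 1)) (b : Fin n → Fin (n + 1)) (hb hx) :
    insertPerm y x b hb hx y = x := by
  simp [insertPerm]

@[simp]
theorem insertPerm_apply_succAbove {n : ℕ} (y x : Fin (n + 1)) (b : Fin n → Fin (n + 1)) (hb hx)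
    (i : Fin n) : insertPerm y x b hb hx (y.succAbove i) = b i := by
  simp [insertPerm]

theorem val_succAbove_eq_ite {n : ℕ} (y : Fin (n + 1)) (i : Fin n) :
    (y.succAbove i : ℕ) = if (i : ℕ) < y then (i : ℕ) else i + 1 := by
  unfold Fin.succAbove
  simp only [Fin.lt_def, Fin.val_castSucc]
  split_ifs <;> rfl

theorem card_filter_succAbove {n : ℕ} (y : Fin (n + 1)) (P : Fin (n + 1) → Prop)
    [DecidablePred P] :
    #{l | P l} = (if P y then 1 else 0) + #{i : Fin n | P (y.succAbove i)} := by
  simp only [card_filter, Fin.sum_univ_succAbove _ y]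

/-- The smallest element of `F ∪ {n}` that is at least `v`. -/
noncomputable def nextLetter (F : Finset ℕ) (n v : ℕ) : ℕ := sInf {w | v ≤ w ∧ (w ∈ F ∨ w = n)}

section nextLetter

variable {F : Finset ℕ} {n v w y : ℕ}

theorem nextLetter_spec (hv : v ≤ n) :
    v ≤ nextLetter F n v ∧ (nextLetter F n v ∈ F ∨ nextLetter F n v = n) :=
  Nat.sInf_mem (s := {w | v ≤ w ∧ (w ∈ F ∨ w = n)}) ⟨n, hv, Or.inr rfl⟩

theorem le_nextLetter (hv : v ≤ n) : v ≤ nextLetter F n v := (nextLetter_spec hv).1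

theorem nextLetter_mem (hv : v ≤ n) : nextLetter F n v ∈ F ∨ nextLetter F n v = n :=
  (nextLetter_spec hv).2

theorem nextLetter_le (hw : w ∈ F) (h : v ≤ w) : nextLetter F n v ≤ w := Nat.sInf_le ⟨h, Or.inl hw⟩

theorem nextLetter_le_max (hv : v ≤ n) : nextLetter F n v ≤ n := Nat.sInf_le ⟨hv, Or.inr rfl⟩

/-- Replace each letter of `F` that is at least `y` by the following letter of `F ∪ {n}`. -/
noncomputable def bump (F : Finset ℕ) (n y v : ℕ) : ℕ :=
  if v ∈ F ∧ y ≤ v then nextLetter F n (v + 1) else v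

theorem bump_of_mem (h : v ∈ F) (hy : y ≤ v) : bump F n y v = nextLetter F n (v + 1) :=
  if_pos ⟨h, hy⟩

theorem lt_bump (h : v ∈ F) (hy : y ≤ v) (hv : v < n) : v < bump F n y v := by
  rw [bump_of_mem h hy]
  exact le_nextLetter hv

theorem bump_of_notMem (h : v ∉ F) : bump F n y v = v := if_neg fun h' => h h'.1

theorem bump_of_lt (h : v < y) : bump F n y v = v := if_neg fun h' => by omega

theorem le_bump (hv : v < n) : v ≤ bump F n y v := by
  unfold bump
  split_ifs
  · exact (le_nextLetter (v := v + 1) hv).trans' (Nat.le_succ v)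
  · exact le_rfl

theorem bump_le (hv : v < n) : bump F n y v ≤ n := by
  unfold bump
  split_ifs
  · exact nextLetter_le_max hv
  · exact hv.le

theorem bump_mem (h : v ∈ F) (hv : v < n) : bump F n y v ∈ F ∨ bump F n y v = n := by
  unfold bump
  split_ifs
  · exact nextLetter_mem hv
  · exact Or.inl h

theorem bump_lt_bump (hw : w ∈ F) (hvw : v < w) (hwn : w < n) : bump F n y v < bump F n y w := by
  have h1 : w ≤ bump F n y w := le_bump hwn
  by_cases hvF : v ∈ F ∧ y ≤ v
  · rw [bump_of_mem hvF.1 hvF.2]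
    have h2 : nextLetter F n (v + 1) ≤ w := nextLetter_le hw hvw
    have h3 := lt_bump (n := n) hw (hvF.2.trans hvw.le) hwn
    omega
  · have : bump F n y v = v := if_neg hvF
    omega

theorem bump_ne_of_lt (hvw : v < w) (hwn : w < n) : bump F n y v ≠ bump F n y w := by
  by_cases hw : w ∈ F
  · exact (bump_lt_bump hw hvw hwn).ne
  · rw [bump_of_notMem hw]
    by_cases hvF : v ∈ F
    · intro h
      rcases bump_mem (y := y) hvF (hvw.trans hwn) with h' | h'
      · exact hw (h ▸ h')
      · omega
    · rw [bump_of_notMem hvF]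
      exact hvw.ne

theorem bump_injOn (hv : v < n) (hw : w < n) (h : bump F n y v = bump F n y w) : v = w := by
  rcases lt_trichotomy v w with h' | h' | h'
  · exact absurd h (bump_ne_of_lt h' hw)
  · exact h'
  · exact absurd h.symm (bump_ne_of_lt h' hv)

theorem nextLetter_lt_bump (hv : v ∈ F) (hvn : v < n) (hy : y ≤ v) :
    nextLetter F n y < bump F n y v :=
  (nextLetter_le hv hy).trans_lt (lt_bump hv hy hvn)

theorem bump_ne_nextLetter (hv : v < n) (hy : y ≤ n) : bump F n y v ≠ nextLetter F n y := by
  intro h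
  have h1 := le_nextLetter (F := F) hy
  have h2 := nextLetter_mem (F := F) hy
  by_cases hvF : v ∈ F
  · by_cases hyv : y ≤ v
    · exact (nextLetter_lt_bump hvF hv hyv).ne' h
    · rw [bump_of_lt (by omega)] at h
      omega
  · rw [bump_of_notMem hvF] at h
    rcases h2 with h2 | h2
    · exact hvF (h ▸ h2)
    · omega

theorem nextLetter_eq_self_iff (hy : y ≤ n) : nextLetter F n y = y ↔ y ∈ F ∨ y = n := by
  constructor
  · intro h
    have := nextLetter_mem (F := F) hy
    rwa [h] at this
  · rintro (h | h)
    · exact le_antisymm (nextLetter_le h le_rfl) (le_nextLetter hy)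
    · exact le_antisymm ((nextLetter_le_max hy).trans h.ge) (le_nextLetter hy)

end nextLetter

/-- The set of values of a permutation taken at excedances. -/
def excLetters {n : ℕ} (σ : Equiv.Perm (Fin n)) : Finset ℕ :=
  (univ.filter fun i : Fin n => i < σ i).image fun i => (σ i : ℕ)

section excLetters

variable {n : ℕ}

theorem mem_excLetters (σ : Equiv.Perm (Fin n)) (v : ℕ) :
    v ∈ excLetters σ ↔ ∃ i, i < σ i ∧ (σ i : ℕ) = v := by
  simp [excLetters]

theorem apply_mem_excLetters (σ : Equiv.Perm (Fin n)) (i : Fin n) :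
    (σ i : ℕ) ∈ excLetters σ ↔ i < σ i := by
  rw [mem_excLetters]
  constructor
  · rintro ⟨j, hj, h⟩
    rwa [← σ.injective (Fin.ext h)]
  · exact fun h => ⟨i, h, rfl⟩

theorem lt_of_mem_excLetters {σ : Equiv.Perm (Fin n)} {v : ℕ} (h : v ∈ excLetters σ) : v < n := by
  obtain ⟨i, -, rfl⟩ := (mem_excLetters σ v).1 h
  exact (σ i).isLt

theorem injective_val_comp (σ : Equiv.Perm (Fin n)) : Function.Injective fun i => (σ i : ℕ) :=
  fun _ _ h => σ.injective (Fin.ext h)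

theorem excStat_eq_card_excLetters (σ : Equiv.Perm (Fin n)) : excStat σ = #(excLetters σ) :=
  (card_image_of_injective _ (injective_val_comp σ)).symm

theorem card_excLetters_ge (σ : Equiv.Perm (Fin n)) (y : ℕ) :
    #{f ∈ excLetters σ | y ≤ f} = #{i : Fin n | i < σ i ∧ y ≤ (σ i : ℕ)} := by
  rw [excLetters, filter_image, card_image_of_injective _ (injective_val_comp σ), filter_filter]

end excLetters

/-- Han's insertion: bump the excedance letters that are at least `y`, then insert at position `y`
the smallest letter that is at least `y` and is either an excedance letter or the new maximum. -/
noncomputable def excInsert {n : ℕ} (σ : Equiv.Perm (Fin n)) (y : Fin (n + 1)) :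
    Equiv.Perm (Fin (n + 1)) :=
  insertPerm y
    ⟨nextLetter (excLetters σ) n y, Nat.lt_succ_of_le (nextLetter_le_max (Nat.le_of_lt_succ y.2))⟩
    (fun i => ⟨bump (excLetters σ) n y (σ i), Nat.lt_succ_of_le (bump_le (σ i).2)⟩)
    (fun i j h => σ.injective (Fin.ext (bump_injOn (σ i).2 (σ j).2 (Fin.ext_iff.1 h))))
    (fun i h => bump_ne_nextLetter (σ i).2 (Nat.le_of_lt_succ y.2) (Fin.ext_iff.1 h))

section excInsert

variable {n : ℕ} (σ : Equiv.Perm (Fin n)) (y : Fin (n + 1))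

theorem val_excInsert_self : (excInsert σ y y : ℕ) = nextLetter (excLetters σ) n y :=
  congrArg Fin.val (insertPerm_apply_self ..)

theorem val_excInsert_succAbove (i : Fin n) :
    (excInsert σ y (y.succAbove i) : ℕ) = bump (excLetters σ) n y (σ i) :=
  congrArg Fin.val (insertPerm_apply_succAbove ..)

theorem lt_excInsert_self_iff :
    y < excInsert σ y y ↔ ¬ ((y : ℕ) ∈ excLetters σ ∨ (y : ℕ) = n) := by
  have hy : (y : ℕ) ≤ n := Nat.le_of_lt_succ y.2
  rw [← nextLetter_eq_self_iff hy, Fin.lt_def, val_excInsert_self]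
  have := le_nextLetter (F := excLetters σ) hy
  omega

theorem succAbove_lt_excInsert_iff (i : Fin n) :
    y.succAbove i < excInsert σ y (y.succAbove i) ↔ i < σ i := by
  rw [Fin.lt_def, val_excInsert_succAbove, val_succAbove_eq_ite]
  have h1 := le_bump (F := excLetters σ) (y := y) (σ i).2
  by_cases hi : i < σ i
  · have hi' := Fin.lt_def.1 hi
    simp only [hi, iff_true]
    split_ifs with h
    · omega
    · have := lt_bump (n := n) (y := y) ((apply_mem_excLetters σ i).2 hi) (by omega) (σ i).2
      omega
  · have hi' := fun h => hi (Fin.lt_def.2 h)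
    rw [bump_of_notMem fun h => hi ((apply_mem_excLetters σ i).1 h)]
    split_ifs <;> omega

theorem excStat_excInsert :
    excStat (excInsert σ y) =
      excStat σ + if (y : ℕ) ∈ excLetters σ ∨ (y : ℕ) = n then 0 else 1 := by
  unfold excStat
  rw [card_filter_succAbove y]
  simp only [lt_excInsert_self_iff, succAbove_lt_excInsert_iff]
  split_ifs <;> omega

theorem denWeight_excInsert_succAbove (i : Fin n) :
    denWeight (excInsert σ y) (y.succAbove i) =
      denWeight σ i + if i < σ i ∧ (y : ℕ) ≤ i then 1 else 0 := by
  have hy : (y : ℕ) ≤ n := Nat.le_of_lt_succ y.2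
  unfold denWeight
  simp only [succAbove_lt_excInsert_iff]
  by_cases hi : i < σ i
  · have hi' := Fin.lt_def.1 hi
    have hF := (apply_mem_excLetters σ i).2 hi
    have h1 := le_bump (F := excLetters σ) (y := y) (σ i).2
    simp only [hi, if_true, true_and]
    rw [card_filter_succAbove y, if_neg]
    · have h2 : #{l : Fin n | y.succAbove l < y.succAbove i ∧
          excInsert σ y (y.succAbove i) < excInsert σ y (y.succAbove l)} =
          #{l : Fin n | l < i ∧ σ i < σ l} := by
        congr 1
        ext l
        simp only [mem_filter, mem_univ, true_and, Fin.succAbove_lt_succAbove_iff]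
        refine and_congr_right fun hl => ?_
        simp only [Fin.lt_def, val_excInsert_succAbove]
        by_cases hlF : (σ l : ℕ) ∈ excLetters σ
        · constructor
          · intro h
            by_contra hcon
            have hne : (σ l : ℕ) ≠ σ i := fun h => hl.ne (σ.injective (Fin.ext h))
            have := bump_lt_bump (n := n) (y := y) (v := σ l) hF (by omega) (σ i).2
            omega
          · intro h
            exact bump_lt_bump hlF h (σ l).2
        · rw [bump_of_notMem hlF]
          rw [apply_mem_excLetters, Fin.lt_def] at hlF
          rw [Fin.lt_def] at hl
          omega
      rw [h2, val_succAbove_eq_ite]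
      split_ifs <;> omega
    · rintro ⟨h2, h3⟩
      rw [Fin.lt_def, val_succAbove_eq_ite] at h2
      rw [Fin.lt_def, val_excInsert_self, val_excInsert_succAbove] at h3
      have := nextLetter_lt_bump (n := n) (y := y) hF (σ i).2 (by split_ifs at h2 <;> omega)
      omega
  · have hi' := fun h => hi (Fin.lt_def.2 h)
    have hF := fun h => hi ((apply_mem_excLetters σ i).1 h)
    simp only [hi, if_false, false_and, add_zero]
    rw [card_filter_succAbove y, if_neg, zero_add]
    · congr 1
      ext l
      simp only [mem_filter, mem_univ, true_and, Fin.succAbove_lt_succAbove_iff]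
      refine and_congr_right fun hl => ?_
      simp only [Fin.lt_def, val_excInsert_succAbove, bump_of_notMem hF]
      have h1 := le_bump (F := excLetters σ) (y := y) (σ l).2
      by_cases hlF : (σ l : ℕ) ∈ excLetters σ
      · rw [apply_mem_excLetters, Fin.lt_def] at hlF
        rw [Fin.lt_def] at hl
        omega
      · rw [bump_of_notMem hlF]
    · rintro ⟨h2, h3⟩
      rw [Fin.lt_def, val_succAbove_eq_ite] at h2
      rw [Fin.lt_def, val_excInsert_self, val_excInsert_succAbove, bump_of_notMem hF] at h3
      have := le_nextLetter (F := excLetters σ) hy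
      split_ifs at h2 <;> omega

theorem denWeight_excInsert_self :
    denWeight (excInsert σ y) y = #{i : Fin n | (i : ℕ) < y ∧ (y : ℕ) ≤ (σ i : ℕ)} +
      if (y : ℕ) ∈ excLetters σ ∨ (y : ℕ) = n then 0 else (y : ℕ) + 1 := by
  have hy : (y : ℕ) ≤ n := Nat.le_of_lt_succ y.2
  unfold denWeight
  simp only [lt_excInsert_self_iff]
  by_cases h : (y : ℕ) ∈ excLetters σ ∨ (y : ℕ) = n
  · have hnext := (nextLetter_eq_self_iff hy).2 h
    simp only [h, not_true_eq_false, if_false, if_true, add_zero]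
    rw [card_filter_succAbove y, if_neg (by simp), zero_add,
      ← card_le_apply_lt_eq_card_lt_le_apply]
    congr 1
    ext i
    simp only [mem_filter, mem_univ, true_and, Fin.lt_def, val_excInsert_self,
      val_excInsert_succAbove, val_succAbove_eq_ite, hnext]
    by_cases hi : (σ i : ℕ) < y
    · rw [bump_of_lt hi]
      split_ifs <;> omega
    · have h1 := le_bump (F := excLetters σ) (y := y) (σ i).2
      omega
  · simp only [h, not_false_eq_true, if_true, if_false]
    rw [card_filter_succAbove y, if_neg (by simp), zero_add, add_comm]
    congr 2
    ext i
    simp only [mem_filter, mem_univ, true_and, Fin.lt_def, val_excInsert_self,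
      val_excInsert_succAbove, val_succAbove_eq_ite]
    by_cases hi : (i : ℕ) < y
    · simp only [hi, if_true, true_and]
      by_cases hyi : (y : ℕ) ≤ σ i
      · have := nextLetter_lt_bump (n := n) (y := y) ((apply_mem_excLetters σ i).2
          (Fin.lt_def.2 (by omega))) (σ i).2 hyi
        simp only [this, hyi]
      · rw [bump_of_lt (by omega)]
        have := le_nextLetter (F := excLetters σ) hy
        omega
    · simp only [hi, if_false, false_and, iff_false]
      omega

theorem denStat_excInsert :
    denStat (excInsert σ y) = denStat σ + #{f ∈ excLetters σ | (y : ℕ) ≤ f} +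
      if (y : ℕ) ∈ excLetters σ ∨ (y : ℕ) = n then 0 else (y : ℕ) + 1 := by
  have h : #{f ∈ excLetters σ | (y : ℕ) ≤ f} = #{i : Fin n | (i : ℕ) < y ∧ (y : ℕ) ≤ (σ i : ℕ)} +
      #{i : Fin n | i < σ i ∧ (y : ℕ) ≤ i} := by
    rw [card_excLetters_ge, ← card_filter_add_card_filter_not (fun i : Fin n => (i : ℕ) < y),
      filter_filter, filter_filter]
    congr 2
    · ext i
      simp only [mem_filter, mem_univ, true_and, Fin.lt_def]
      omega
    · ext i
      simp only [mem_filter, mem_univ, true_and, Fin.lt_def]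
      omega
  simp only [denStat_eq_sum_denWeight, Fin.sum_univ_succAbove _ y, denWeight_excInsert_self,
    denWeight_excInsert_succAbove, sum_add_distrib, ← card_filter, h]
  ring

theorem mem_excLetters_excInsert_of_mem {f : ℕ} (hf : f ∈ excLetters σ) (hfy : f ≠ y) :
    f ∈ excLetters (excInsert σ y) := by
  have hy : (y : ℕ) ≤ n := Nat.le_of_lt_succ y.2
  have hfn := lt_of_mem_excLetters hf
  obtain ⟨j, hj⟩ := (excInsert σ y).surjective ⟨f, by omega⟩
  have hj' : (excInsert σ y j : ℕ) = f := by rw [hj]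
  rw [← hj', apply_mem_excLetters]
  rcases Fin.eq_self_or_eq_succAbove y j with rfl | ⟨i, rfl⟩
  · rw [Fin.lt_def]
    have := le_nextLetter (F := excLetters σ) hy
    rw [val_excInsert_self] at hj' ⊢
    omega
  · rw [succAbove_lt_excInsert_iff, ← apply_mem_excLetters]
    by_contra hi
    rw [val_excInsert_succAbove, bump_of_notMem hi] at hj'
    exact hi (hj' ▸ hf)

theorem mem_of_mem_excLetters_excInsert {f : ℕ} (hf : f ∈ excLetters (excInsert σ y)) :
    f ∈ excLetters σ ∨ f = n := by
  obtain ⟨j, hj, rfl⟩ := (mem_excLetters _ _).1 hf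
  rcases Fin.eq_self_or_eq_succAbove y j with rfl | ⟨i, rfl⟩
  · rw [val_excInsert_self]
    exact nextLetter_mem (Nat.le_of_lt_succ j.2)
  · rw [val_excInsert_succAbove]
    rw [succAbove_lt_excInsert_iff, ← apply_mem_excLetters] at hj
    exact bump_mem hj (σ i).2

theorem mem_excLetters_iff_excInsert (f : ℕ) :
    f ∈ excLetters σ ↔ f < n ∧ (f ∈ excLetters (excInsert σ y) ∨
      (f = y ∧ (excInsert σ y y : ℕ) = y)) := by
  have hy : (y : ℕ) ≤ n := Nat.le_of_lt_succ y.2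
  rw [val_excInsert_self, nextLetter_eq_self_iff hy]
  constructor
  · intro hf
    refine ⟨lt_of_mem_excLetters hf, ?_⟩
    by_cases hfy : f = y
    · exact Or.inr ⟨hfy, Or.inl (hfy ▸ hf)⟩
    · exact Or.inl (mem_excLetters_excInsert_of_mem σ y hf hfy)
  · rintro ⟨hfn, hf | ⟨rfl, hf⟩⟩
    · exact (mem_of_mem_excLetters_excInsert σ y hf).resolve_right hfn.ne
    · exact hf.resolve_right hfn.ne

/-- The position `i` is not a strict anti-excedance of `τ`, and no excedance letter lies in
`[i, τ i)`. -/
def IsInsertionSite {m : ℕ} (τ : Equiv.Perm (Fin m)) (i : Fin m) : Prop :=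
  i ≤ τ i ∧ ∀ w ∈ excLetters τ, (i : ℕ) ≤ w → (τ i : ℕ) ≤ w

theorem isInsertionSite_excInsert : IsInsertionSite (excInsert σ y) y := by
  have hy : (y : ℕ) ≤ n := Nat.le_of_lt_succ y.2
  refine ⟨?_, fun w hw hyw => ?_⟩
  · rw [Fin.le_def, val_excInsert_self]
    exact le_nextLetter hy
  · rw [val_excInsert_self]
    rcases mem_of_mem_excLetters_excInsert σ y hw with h | rfl
    · exact nextLetter_le h hyw
    · exact nextLetter_le_max hy

theorem not_isInsertionSite_excInsert_of_lt {j : Fin (n + 1)} (hj : y < j) :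
    ¬ IsInsertionSite (excInsert σ y) j := by
  rintro ⟨h1, h2⟩
  rcases Fin.eq_self_or_eq_succAbove y j with rfl | ⟨i, rfl⟩
  · exact lt_irrefl _ hj
  · rw [Fin.lt_def] at hj
    rw [Fin.le_def] at h1
    simp only [val_excInsert_succAbove, val_succAbove_eq_ite] at h1 h2 hj
    have hyi : ¬ (i : ℕ) < y := by
      intro h
      rw [if_pos h] at hj
      omega
    simp only [hyi, if_false] at h1 h2
    by_cases hi : (σ i : ℕ) ∈ excLetters σ
    · have hlt := Fin.lt_def.1 ((apply_mem_excLetters σ i).1 hi)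
      have h3 := h2 _ (mem_excLetters_excInsert_of_mem σ y hi (by omega)) hlt
      have := lt_bump (n := n) (y := y) hi (by omega) (σ i).2
      omega
    · rw [bump_of_notMem hi] at h1
      rw [apply_mem_excLetters, Fin.lt_def] at hi
      omega

end excInsert

theorem excInsert_injective {n : ℕ} :
    Function.Injective (Function.uncurry (excInsert (n := n))) := by
  rintro ⟨σ, y⟩ ⟨σ', y'⟩ h
  simp only [Function.uncurry_apply_pair] at h
  have hy : y = y' := by
    rcases lt_trichotomy y y' with hlt | heq | hlt
    · exact absurd (h ▸ isInsertionSite_excInsert σ' y')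
        (not_isInsertionSite_excInsert_of_lt σ y hlt)
    · exact heq
    · exact absurd (h ▸ isInsertionSite_excInsert σ y)
        (not_isInsertionSite_excInsert_of_lt σ' y' hlt)
  subst hy
  have hF : excLetters σ = excLetters σ' := by
    ext f
    rw [mem_excLetters_iff_excInsert σ y, mem_excLetters_iff_excInsert σ' y, h]
  congr 1
  ext i
  have hi := val_excInsert_succAbove σ y i
  rw [h, val_excInsert_succAbove, hF] at hi
  exact (bump_injOn (σ' i).2 (σ i).2 hi).symm

/-- The descent set of a permutation with positions counted from `1`. -/
noncomputable def descPositions {n : ℕ} (σ : Equiv.Perm (Fin n)) : Finset ℕ :=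
  (descSet σ).image fun i : Fin n => (i : ℕ) + 1

/-- Insertion of a new maximal letter at position `y`. -/
noncomputable def maxInsert {n : ℕ} (σ : Equiv.Perm (Fin n)) (y : Fin (n + 1)) :
    Equiv.Perm (Fin (n + 1)) :=
  insertPerm y (Fin.last n) (fun i => (σ i).castSucc)
    ((Fin.castSucc_injective n).comp σ.injective) (fun _ => Fin.castSucc_ne_last _)

section maxInsert

variable {n : ℕ}

theorem mem_descPositions (σ : Equiv.Perm (Fin n)) (d : ℕ) :
    d ∈ descPositions σ ↔ ∃ (h : d < n) (_ : 0 < d), σ ⟨d, h⟩ < σ ⟨d - 1, by omega⟩ := by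
  simp only [descPositions, descSet, mem_image, mem_filter, mem_univ, true_and]
  constructor
  · rintro ⟨i, ⟨h, hi⟩, rfl⟩
    exact ⟨h, Nat.succ_pos _, hi⟩
  · rintro ⟨h, h0, hd⟩
    obtain ⟨d, rfl⟩ := Nat.exists_eq_succ_of_ne_zero h0.ne'
    exact ⟨⟨d, by omega⟩, ⟨h, hd⟩, rfl⟩

theorem lt_of_mem_descPositions {σ : Equiv.Perm (Fin n)} {d : ℕ} (h : d ∈ descPositions σ) :
    d < n :=
  ((mem_descPositions σ d).1 h).1

theorem injective_val_add_one : Function.Injective fun i : Fin n => (i : ℕ) + 1 :=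
  fun _ _ h => Fin.ext (Nat.succ_injective h)

theorem desStat_eq_card_descPositions (σ : Equiv.Perm (Fin n)) : desStat σ = #(descPositions σ) :=
  (card_image_of_injective _ injective_val_add_one).symm

theorem majStat_eq_sum_descPositions (σ : Equiv.Perm (Fin n)) :
    majStat σ = ∑ d ∈ descPositions σ, d :=
  (sum_image (f := fun d : ℕ => d) injective_val_add_one.injOn).symm

variable (σ : Equiv.Perm (Fin n)) (y : Fin (n + 1))

theorem maxInsert_self : maxInsert σ y y = Fin.last n := by
  simp only [maxInsert, insertPerm_apply_self]

theorem maxInsert_succAbove (i : Fin n) : maxInsert σ y (y.succAbove i) = (σ i).castSucc := by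
  simp only [maxInsert, insertPerm_apply_succAbove]

theorem maxInsert_of_lt {j : Fin (n + 1)} (hj : j < y) :
    maxInsert σ y j = (σ ⟨j, by omega⟩).castSucc := by
  rw [← maxInsert_succAbove]
  congr 1
  ext
  rw [val_succAbove_eq_ite, if_pos (Fin.lt_def.1 hj)]

theorem maxInsert_of_gt {j : Fin (n + 1)} (hj : y < j) :
    maxInsert σ y j = (σ ⟨(j : ℕ) - 1, by omega⟩).castSucc := by
  rw [← maxInsert_succAbove]
  congr 1
  ext
  rw [Fin.lt_def] at hj
  rw [val_succAbove_eq_ite, if_neg (by simp only; omega)]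
  simp only
  omega

theorem mem_descPositions_maxInsert (d : ℕ) :
    d ∈ descPositions (maxInsert σ y) ↔ (d < y ∧ d ∈ descPositions σ) ∨
      (d = y + 1 ∧ (y : ℕ) < n) ∨ ((y : ℕ) + 1 < d ∧ d - 1 ∈ descPositions σ) := by
  simp only [mem_descPositions]
  have hy := y.2
  rcases lt_trichotomy d y with h | h | h
  · have h1 : d < n + 1 := by omega
    constructor
    · rintro ⟨h1, h2, h3⟩
      refine Or.inl ⟨h, by omega, h2, ?_⟩
      rw [maxInsert_of_lt σ y (Fin.lt_def.2 h),
        maxInsert_of_lt σ y (Fin.lt_def.2 (by simp only; omega))] at h3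
      exact h3
    · rintro (⟨-, h1, h2, h3⟩ | h' | h')
      · refine ⟨by omega, h2, ?_⟩
        rw [maxInsert_of_lt σ y (Fin.lt_def.2 h),
          maxInsert_of_lt σ y (Fin.lt_def.2 (by simp only; omega))]
        exact h3
      · omega
      · omega
  · constructor
    · rintro ⟨h1, h2, h3⟩
      have : (⟨d, h1⟩ : Fin (n + 1)) = y := Fin.ext h
      rw [this, maxInsert_self] at h3
      exact absurd h3 (Fin.le_last _).not_gt
    · rintro (h | h | h) <;> omega
  · rcases (Nat.succ_le_of_lt h).eq_or_lt with h' | h'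
    · constructor
      · rintro ⟨h1, h2, h3⟩
        exact Or.inr (Or.inl ⟨h'.symm, by omega⟩)
      · rintro (h | ⟨-, hyn⟩ | h)
        · omega
        · refine ⟨by omega, by omega, ?_⟩
          have : (⟨d - 1, by omega⟩ : Fin (n + 1)) = y := Fin.ext (by simp only; omega)
          rw [this, maxInsert_self, maxInsert_of_gt σ y (Fin.lt_def.2 h)]
          exact Fin.castSucc_lt_last _
        · omega
    · constructor
      · rintro ⟨h1, h2, h3⟩
        refine Or.inr (Or.inr ⟨h', by omega, by omega, ?_⟩)
        rw [maxInsert_of_gt σ y (Fin.lt_def.2 h),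
          maxInsert_of_gt σ y (Fin.lt_def.2 (by simp only; omega))] at h3
        exact h3
      · rintro (h | h | ⟨-, h1, h2, h3⟩)
        · omega
        · omega
        · refine ⟨by omega, by omega, ?_⟩
          rw [maxInsert_of_gt σ y (Fin.lt_def.2 h),
            maxInsert_of_gt σ y (Fin.lt_def.2 (by simp only; omega))]
          exact h3

theorem sum_descPositions_maxInsert (g : ℕ → ℕ) :
    ∑ d ∈ descPositions (maxInsert σ y), g d =
      ∑ d ∈ descPositions σ with d < (y : ℕ), g d + (if (y : ℕ) < n then g (y + 1) else 0) +
        ∑ d ∈ descPositions σ with (y : ℕ) < d, g (d + 1) := by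
  have h : descPositions (maxInsert σ y) = ({d ∈ descPositions σ | d < (y : ℕ)} ∪
      (if (y : ℕ) < n then {(y : ℕ) + 1} else ∅)) ∪
      ({d ∈ descPositions σ | (y : ℕ) < d}).image (· + 1) := by
    ext d
    rw [mem_descPositions_maxInsert]
    simp only [mem_union, mem_filter, mem_image]
    have h2 : d ∈ (if (y : ℕ) < n then {(y : ℕ) + 1} else ∅ : Finset ℕ) ↔
        d = y + 1 ∧ (y : ℕ) < n := by
      split_ifs with h <;> simp [h]
    have h3 : (∃ a, (a ∈ descPositions σ ∧ (y : ℕ) < a) ∧ a + 1 = d) ↔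
        ((y : ℕ) + 1 < d ∧ d - 1 ∈ descPositions σ) := by
      constructor
      · rintro ⟨a, ⟨h1, h2⟩, rfl⟩
        exact ⟨by omega, h1⟩
      · rintro ⟨h1, h2⟩
        exact ⟨d - 1, ⟨h2, by omega⟩, by omega⟩
    rw [h2, h3]
    tauto
  rw [h, sum_union, sum_union, sum_image]
  · congr 2
    split_ifs <;> simp
  · exact (add_left_injective 1).injOn
  · rw [Finset.disjoint_left]
    intro d hd hd'
    split_ifs at hd' <;> simp at hd hd'
    omega
  · rw [Finset.disjoint_left]
    intro d hd hd'
    simp only [mem_image, mem_filter] at hd'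
    obtain ⟨a, ⟨-, ha⟩, rfl⟩ := hd'
    rw [mem_union] at hd
    split_ifs at hd <;> simp at hd <;> omega

theorem sum_eq_sum_lt_add_sum_gt (D : Finset ℕ) (a : ℕ) (g : ℕ → ℕ) :
    ∑ d ∈ D, g d = ∑ d ∈ D with d < a, g d + (if a ∈ D then g a else 0) +
      ∑ d ∈ D with a < d, g d := by
  rw [← sum_ite_eq D a g, sum_filter, sum_filter, ← sum_add_distrib, ← sum_add_distrib]
  refine sum_congr rfl fun d _ => ?_
  rcases lt_trichotomy d a with h | rfl | h
  · simp [h, h.ne', h.not_gt]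
  · simp
  · simp [h, h.ne, h.not_gt]

theorem desStat_maxInsert :
    desStat (maxInsert σ y) =
      desStat σ + if (y : ℕ) ∈ descPositions σ ∨ (y : ℕ) = n then 0 else 1 := by
  have h1 := sum_descPositions_maxInsert σ y (fun _ => 1)
  have h2 := sum_eq_sum_lt_add_sum_gt (descPositions σ) y (fun _ => 1)
  rw [← card_eq_sum_ones, ← desStat_eq_card_descPositions] at h1 h2
  have hy := y.2
  have h3 : (y : ℕ) ∈ descPositions σ → (y : ℕ) < n := lt_of_mem_descPositions
  rw [h1, h2]
  split_ifs <;> grind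

theorem majStat_maxInsert :
    majStat (maxInsert σ y) = majStat σ + #{f ∈ descPositions σ | (y : ℕ) ≤ f} +
      if (y : ℕ) ∈ descPositions σ ∨ (y : ℕ) = n then 0 else (y : ℕ) + 1 := by
  have h1 := sum_descPositions_maxInsert σ y (fun d => d)
  have h2 := sum_eq_sum_lt_add_sum_gt (descPositions σ) y (fun d => d)
  have h4 := sum_eq_sum_lt_add_sum_gt {f ∈ descPositions σ | (y : ℕ) ≤ f} y (fun _ => 1)
  rw [← majStat_eq_sum_descPositions] at h1 h2
  have h5 : {d ∈ ({f ∈ descPositions σ | (y : ℕ) ≤ f} : Finset ℕ) | d < (y : ℕ)} = ∅ := by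
    ext d
    simp only [mem_filter, notMem_empty, iff_false]
    omega
  have h6 : {d ∈ ({f ∈ descPositions σ | (y : ℕ) ≤ f} : Finset ℕ) | (y : ℕ) < d} =
      {d ∈ descPositions σ | (y : ℕ) < d} := by
    ext d
    simp only [mem_filter]
    grind
  rw [← card_eq_sum_ones, h5, h6, sum_empty, zero_add] at h4
  simp only [mem_filter, le_refl, and_true] at h4
  rw [sum_add_distrib] at h1
  have hy := y.2
  have h3 : (y : ℕ) ∈ descPositions σ → (y : ℕ) < n := lt_of_mem_descPositions
  rw [h1, h2, h4]
  split_ifs <;> grind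

end maxInsert

theorem maxInsert_injective {n : ℕ} :
    Function.Injective (Function.uncurry (maxInsert (n := n))) := by
  rintro ⟨σ, y⟩ ⟨σ', y'⟩ h
  simp only [Function.uncurry_apply_pair] at h
  have hy : y = y' := by
    apply (maxInsert σ y).injective
    rw [maxInsert_self, h, maxInsert_self]
  subst hy
  congr 1
  ext i
  have hi := maxInsert_succAbove σ y i
  rw [h, maxInsert_succAbove] at hi
  rw [Fin.castSucc_injective n hi]

theorem sum_excStat_denStat_eq_sum_desStat_majStat {M : Type*} [AddCommMonoid M] (n : ℕ) :
    ∀ f : ℕ → ℕ → M, ∑ σ : Equiv.Perm (Fin n), f (excStat σ) (denStat σ) =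
      ∑ σ : Equiv.Perm (Fin n), f (desStat σ) (majStat σ) := by
  induction n with
  | zero =>
    intro f
    simp [excStat, denStat, desStat, majStat, descSet]
  | succ n ih =>
    intro f
    rw [sum_perm_succ_of_insertion excInsert excInsert_injective excLetters
        (fun _ _ => lt_of_mem_excLetters) excStat denStat excStat denStat
        excStat_eq_card_excLetters excStat_excInsert denStat_excInsert,
      sum_perm_succ_of_insertion maxInsert maxInsert_injective descPositions
        (fun _ _ => lt_of_mem_descPositions) desStat majStat desStat majStat
        desStat_eq_card_descPositions desStat_maxInsert majStat_maxInsert]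
    exact ih fun e d => ∑ s ∈ range e, f e (d + (s + 1)) +
      ∑ s ∈ Ico e n, f (e + 1) (d + (s + 1)) + f e d

theorem statement13 {R : Type*} [CommRing R] (p q : R) (n : ℕ) :
    ∑ σ : Equiv.Perm (Fin n), p ^ excStat σ * q ^ denStat σ =
      ∑ σ : Equiv.Perm (Fin n), p ^ desStat σ * q ^ majStat σ := by
  exact sum_excStat_denStat_eq_sum_desStat_majStat n fun e d => p ^ e * q ^ d
end
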